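/- arXiv:2603.05326 — 9 statements merged into one kernel-verified Lean document; each statement's English description precedes it below -/
import Mathlib

section
/- Let N ≥ 1, let p : Fin N → ℝ be strictly positive prices, let w : Fin N → ℝ be a weight vector on the simplex (w_i > 0 for all i and ∑_i w_i = 1), and let k > 0. Then over all reserve vectors R : Fin N → ℝ with R_i > 0 for all i and ∏_i R_i^{w_i} = k, the minimum of the pool value ∑_i p_i R_i equals k · ∏_i (p_i / w_i)^{w_i}, and this minimum is attained at a reserve vector R if and only if p_i R_i = w_i · (∑_j p_j R_j) for every i. -/
theorem prod_div_mul_rpow {ι : Type*} (s : Finset ι) {p w R : ι → ℝ}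
    (hp : ∀ i ∈ s, 0 ≤ p i) (hw : ∀ i ∈ s, 0 ≤ w i) (hR : ∀ i ∈ s, 0 ≤ R i) :
    ∏ i ∈ s, (p i * R i / w i) ^ w i =
      (∏ i ∈ s, R i ^ w i) * ∏ i ∈ s, (p i / w i) ^ w i := by
  rw [← Finset.prod_mul_distrib]
  refine Finset.prod_congr rfl fun i hi => ?_
  rw [← Real.mul_rpow (hR i hi) (div_nonneg (hp i hi) (hw i hi))]
  congr 1
  ring


/-- For a G3M pool with strictly positive prices `p`, weight vector `w` on the
simplex, and invariant value `k > 0`, the minimum of the pool value `∑ i, p i * R i` over all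
strictly positive reserve vectors `R` with `∏ i, R i ^ w i = k` equals
`k * ∏ i, (p i / w i) ^ w i`, and this minimum is attained at such an `R` iff
`p i * R i = w i * ∑ j, p j * R j` for every `i`. -/
theorem g3m_min_value (N : ℕ) (hN : 1 ≤ N) (p w : Fin N → ℝ)
    (hp : ∀ i, 0 < p i) (hw : ∀ i, 0 < w i) (hw1 : ∑ i, w i = 1)
    (k : ℝ) (hk : 0 < k) :
    IsLeast {v : ℝ | ∃ R : Fin N → ℝ, (∀ i, 0 < R i) ∧ (∏ i, R i ^ w i = k) ∧
        v = ∑ i, p i * R i} (k * ∏ i, (p i / w i) ^ w i) ∧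
    ∀ R : Fin N → ℝ, (∀ i, 0 < R i) → (∏ i, R i ^ w i = k) →
      ((∑ i, p i * R i = k * ∏ i, (p i / w i) ^ w i) ↔
        ∀ i, p i * R i = w i * ∑ j, p j * R j) := by
  have hsum (R : Fin N → ℝ) : ∑ i, w i * (p i * R i / w i) = ∑ i, p i * R i :=
    Finset.sum_congr rfl fun i _ => mul_div_cancel₀ _ (hw i).ne'
  have hprod (R : Fin N → ℝ) (hR : ∀ i, 0 < R i) :
      ∏ i, (p i * R i / w i) ^ w i = (∏ i, R i ^ w i) * ∏ i, (p i / w i) ^ w i :=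
    prod_div_mul_rpow _ (fun i _ => (hp i).le) (fun i _ => (hw i).le) fun i _ => (hR i).le
  have hz (R : Fin N → ℝ) (hR : ∀ i, 0 < R i) : ∀ i ∈ Finset.univ, 0 ≤ p i * R i / w i :=
    fun i _ => (div_pos (mul_pos (hp i) (hR i)) (hw i)).le
  have hP : 0 < ∏ i, (p i / w i) ^ w i :=
    Finset.prod_pos fun i _ => Real.rpow_pos_of_pos (div_pos (hp i) (hw i)) _
  refine ⟨⟨?_, ?_⟩, fun R hR hRk => ?_⟩
  · set C := k * ∏ i, (p i / w i) ^ w i with hC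
    have hC0 : 0 < C := mul_pos hk hP
    have hR (i : Fin N) : 0 < C * w i / p i := div_pos (mul_pos hC0 (hw i)) (hp i)
    have hval (i : Fin N) : p i * (C * w i / p i) = C * w i := mul_div_cancel₀ _ (hp i).ne'
    refine ⟨fun i => C * w i / p i, hR, ?_, ?_⟩
    · have h := hprod _ hR
      rw [Real.geom_mean_weighted_of_constant _ w _ C (fun i _ => (hw i).le) hw1 (hz _ hR)
        fun i _ _ => by rw [hval, mul_div_cancel_right₀ _ (hw i).ne']] at h
      exact (mul_right_cancel₀ hP.ne' (hC.symm.trans h)).symm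
    · simp only [hval]
      rw [← Finset.mul_sum, hw1, mul_one]
  · rintro v ⟨R, hR, hRk, rfl⟩
    rw [← hRk, ← hprod R hR, ← hsum R]
    exact Real.geom_mean_le_arith_mean_weighted _ w _ (fun i _ => (hw i).le) hw1 (hz R hR)
  · have h := Real.geom_mean_eq_arith_mean_weighted_iff_of_pos' _ w _ (fun i _ => hw i) hw1 (hz R hR)
    rw [hsum, hprod R hR, hRk] at h
    rw [eq_comm, h]
    simp only [Finset.mem_univ, true_imp_iff]
    exact forall_congr' fun i => by rw [div_eq_iff (hw i).ne', mul_comm (w i)]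
end

section
/- Let N ≥ 1 and let wˢ and wᵉ be weight vectors on the simplex with wˢ ≠ wᵉ. Let η ˢ_i = √(wˢ_i), η ᵉ_i = √(wᵉ_i), Ω = arccos(∑_i √(wˢ_i · wᵉ_i)), and define the SLERP curve η(t)_i = (sin((1−t)Ω)·η ˢ_i + sin(tΩ)·η ᵉ_i)/sin Ω with associated weights w^SLERP(t)_i = (η(t)_i)². Then the SLERP midpoint weights equal the (AM+GM)/normalise midpoint exactly: w^SLERP(1/2)_i = (AM_i + GM_i) / ∑_j (AM_j + GM_j), where AM_i = (wˢ_i + wᵉ_i)/2 and GM_i = √(wˢ_i · wᵉ_i). -/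
theorem sum_sqrt_mul_nonneg {ι : Type*} [Fintype ι] (p q : ι → ℝ) :
    0 ≤ ∑ i, Real.sqrt (p i * q i) :=
  Finset.sum_nonneg fun _ _ => Real.sqrt_nonneg _

theorem half_add_sub_sqrt_mul {x y : ℝ} (hx : 0 ≤ x) (hy : 0 ≤ y) :
    (x + y) / 2 - Real.sqrt (x * y) = (Real.sqrt x - Real.sqrt y) ^ 2 / 2 := by
  rw [Real.sqrt_mul hx, sub_sq, Real.sq_sqrt hx, Real.sq_sqrt hy]
  ring

theorem half_add_add_sqrt_mul {x y : ℝ} (hx : 0 ≤ x) (hy : 0 ≤ y) :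
    (x + y) / 2 + Real.sqrt (x * y) = (Real.sqrt x + Real.sqrt y) ^ 2 / 2 := by
  rw [Real.sqrt_mul hx, add_sq, Real.sq_sqrt hx, Real.sq_sqrt hy]
  ring

/-- The Bhattacharyya coefficient of two distinct probability vectors is less than one. -/
theorem sum_sqrt_mul_lt_one {ι : Type*} [Fintype ι] {p q : ι → ℝ}
    (hp : ∀ i, 0 ≤ p i) (hp1 : ∑ i, p i = 1) (hq : ∀ i, 0 ≤ q i) (hq1 : ∑ i, q i = 1)
    (hne : p ≠ q) : ∑ i, Real.sqrt (p i * q i) < 1 := by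
  obtain ⟨k, hk⟩ := Function.ne_iff.mp hne
  have hpos : 0 < ∑ i, ((p i + q i) / 2 - Real.sqrt (p i * q i)) := by
    simp only [half_add_sub_sqrt_mul (hp _) (hq _)]
    refine Finset.sum_pos' (fun _ _ => by positivity) ⟨k, Finset.mem_univ k, ?_⟩
    have : Real.sqrt (p k) - Real.sqrt (q k) ≠ 0 :=
      sub_ne_zero.mpr fun h => hk ((Real.sqrt_inj (hp k) (hq k)).mp h)
    positivity
  rw [Finset.sum_sub_distrib, ← Finset.sum_div, Finset.sum_add_distrib, hp1, hq1] at hpos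
  linarith

/-- The squared midpoint of spherical linear interpolation, for an angle `θ` that is not a
multiple of `π`. -/
theorem slerp_midpoint_sq {θ : ℝ} (hθ : Real.sin θ ≠ 0) (a b : ℝ) :
    ((Real.sin (θ / 2) * a + Real.sin (θ / 2) * b) / Real.sin θ) ^ 2 =
      (a + b) ^ 2 / 2 / (1 + Real.cos θ) := by
  have hsin : Real.sin θ = 2 * Real.sin (θ / 2) * Real.cos (θ / 2) := by
    rw [← Real.sin_two_mul, mul_div_cancel₀ θ two_ne_zero]
  have hcos : 1 + Real.cos θ = 2 * Real.cos (θ / 2) ^ 2 := by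
    rw [Real.cos_sq, mul_div_cancel₀ θ two_ne_zero]
    ring
  rw [hsin] at hθ
  have hs : Real.sin (θ / 2) ≠ 0 := right_ne_zero_of_mul (left_ne_zero_of_mul hθ)
  have hc : Real.cos (θ / 2) ≠ 0 := right_ne_zero_of_mul hθ
  rw [hsin, hcos]
  field_simp

/-- The SLERP midpoint (at `t = 1/2`) of the Hellinger-embedded weight vectors,
squared back to weights, equals the (AM+GM)/normalise midpoint exactly, for any number of
tokens and any magnitude of weight change. -/
theorem slerp_midpoint_eq_amgm (N : ℕ) (hN : 1 ≤ N) (ws we : Fin N → ℝ)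
    (hws : ∀ i, 0 < ws i) (hws1 : ∑ i, ws i = 1)
    (hwe : ∀ i, 0 < we i) (hwe1 : ∑ i, we i = 1) (hne : ws ≠ we)
    (Ω : ℝ) (hΩ : Ω = Real.arccos (∑ i, Real.sqrt (ws i * we i))) :
    ∀ i : Fin N,
      ((Real.sin ((1 - 1 / 2) * Ω) * Real.sqrt (ws i)
          + Real.sin ((1 / 2) * Ω) * Real.sqrt (we i)) / Real.sin Ω) ^ 2
        = ((ws i + we i) / 2 + Real.sqrt (ws i * we i)) /
            ∑ j, ((ws j + we j) / 2 + Real.sqrt (ws j * we j)) := by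
  intro i
  have hlt := sum_sqrt_mul_lt_one (fun i => (hws i).le) hws1 (fun i => (hwe i).le) hwe1 hne
  have hnonneg := sum_sqrt_mul_nonneg ws we
  have hcos : Real.cos Ω = ∑ j, Real.sqrt (ws j * we j) := by
    rw [hΩ, Real.cos_arccos (by linarith) hlt.le]
  have hsin : Real.sin Ω ≠ 0 := by
    rw [hΩ, Real.sin_arccos]
    exact (Real.sqrt_pos.mpr (by nlinarith)).ne'
  have hsum : ∑ j, ((ws j + we j) / 2 + Real.sqrt (ws j * we j)) = 1 + Real.cos Ω := by
    rw [Finset.sum_add_distrib, ← Finset.sum_div, Finset.sum_add_distrib, hws1, hwe1, hcos]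
    norm_num
  rw [hsum, half_add_add_sqrt_mul (hws i).le (hwe i).le, ← slerp_midpoint_sq hsin,
    show (1 - 1 / 2) * Ω = Ω / 2 by ring, show 1 / 2 * Ω = Ω / 2 by ring]
end

section
/- Let N ≥ 1 and let wˢ and wᵉ be weight vectors on the simplex with wˢ ≠ wᵉ, with Hellinger images η ˢ, η ᵉ, geodesic angle Ω = arccos(∑_i √(wˢ_i wᵉ_i)), and SLERP curve η(t) = (sin((1−t)Ω)·η ˢ + sin(tΩ)·η ᵉ)/sin Ω with weights w(t)_i = (η(t)_i)². Then for any a, b ∈ [0,1] with a ≠ b, the (AM+GM)/normalise midpoint of the weight vectors w(a) and w(b) equals w((a+b)/2): setting m_i = (w(a)_i + w(b)_i)/2 + √(w(a)_i · w(b)_i), one has m_i / ∑_j m_j = w((a+b)/2)_i. Consequently, recursive midpoint bisection by the (AM+GM)/normalise rule, started from w(0) = wˢ and w(1) = wᵉ, produces exactly the points w(k/2^d) on the SLERP geodesic for all depths d and 0 ≤ k ≤ 2^d. -/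
lemma sin_sq_add_sin_sq_add_two_mul_sin_mul_sin_mul_cos_add (x y : ℝ) :
    Real.sin x ^ 2 + Real.sin y ^ 2 + 2 * (Real.sin x * Real.sin y) * Real.cos (x + y)
      = Real.sin (x + y) ^ 2 := by
  rw [Real.cos_add, Real.sin_add]
  linear_combination (-Real.sin x ^ 2) * Real.sin_sq_add_cos_sq y
    + (-Real.sin y ^ 2) * Real.sin_sq_add_cos_sq x

lemma sum_sqrt_mul_sqrt_lt_one {ι : Type*} [Fintype ι] {u v : ι → ℝ}
    (hu : ∀ i, 0 ≤ u i) (hu1 : ∑ i, u i = 1) (hv : ∀ i, 0 ≤ v i) (hv1 : ∑ i, v i = 1)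
    (huv : u ≠ v) : ∑ i, √(u i) * √(v i) < 1 := by
  obtain ⟨j, hj⟩ := Function.ne_iff.mp huv
  have hpos : 0 < ∑ i, (√(u i) - √(v i)) ^ 2 :=
    Finset.sum_pos' (fun i _ => sq_nonneg _) ⟨j, Finset.mem_univ j, by
      have hne : √(u j) - √(v j) ≠ 0 := fun h =>
        hj ((Real.sqrt_inj (hu j) (hv j)).mp (sub_eq_zero.mp h))
      positivity⟩
  have hexp : ∑ i, (√(u i) - √(v i)) ^ 2
      = ∑ i, u i + ∑ i, v i - 2 * ∑ i, √(u i) * √(v i) := by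
    rw [Finset.mul_sum, ← Finset.sum_add_distrib, ← Finset.sum_sub_distrib]
    refine Finset.sum_congr rfl fun i _ => ?_
    linear_combination Real.sq_sqrt (hu i) + Real.sq_sqrt (hv i)
  linarith

/-- Points of the great circle through two unit vectors `p`, `q` at angle `Ω` are unit vectors. -/
lemma sum_slerp_sq_eq_one {ι : Type*} [Fintype ι] {p q : ι → ℝ} {Ω : ℝ}
    (hp : ∑ i, p i ^ 2 = 1) (hq : ∑ i, q i ^ 2 = 1) (hpq : ∑ i, p i * q i = Real.cos Ω)
    (hΩ : Real.sin Ω ≠ 0) (t : ℝ) :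
    ∑ i, ((Real.sin ((1 - t) * Ω) * p i + Real.sin (t * Ω) * q i) / Real.sin Ω) ^ 2 = 1 := by
  have hexp : ∑ i, (Real.sin ((1 - t) * Ω) * p i + Real.sin (t * Ω) * q i) ^ 2
      = Real.sin ((1 - t) * Ω) ^ 2 * ∑ i, p i ^ 2 + Real.sin (t * Ω) ^ 2 * ∑ i, q i ^ 2
        + 2 * (Real.sin ((1 - t) * Ω) * Real.sin (t * Ω)) * ∑ i, p i * q i := by
    simp only [Finset.mul_sum, ← Finset.sum_add_distrib]
    exact Finset.sum_congr rfl fun i _ => by ring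
  have htrig := sin_sq_add_sin_sq_add_two_mul_sin_mul_sin_mul_cos_add ((1 - t) * Ω) (t * Ω)
  rw [show (1 - t) * Ω + t * Ω = Ω by ring] at htrig
  simp only [div_pow]
  rw [← Finset.sum_div, hexp, hp, hq, hpq, mul_one, mul_one, htrig, div_self (pow_ne_zero 2 hΩ)]

/-- The sum of two points of a SLERP curve is proportional to the point at the mean parameter. -/
lemma slerp_add_slerp (p q Ω a b : ℝ) :
    (Real.sin ((1 - a) * Ω) * p + Real.sin (a * Ω) * q) / Real.sin Ω
        + (Real.sin ((1 - b) * Ω) * p + Real.sin (b * Ω) * q) / Real.sin Ω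
      = 2 * Real.cos ((a - b) / 2 * Ω)
        * ((Real.sin ((1 - (a + b) / 2) * Ω) * p + Real.sin ((a + b) / 2 * Ω) * q)
          / Real.sin Ω) := by
  have h₁ : Real.sin ((1 - a) * Ω) + Real.sin ((1 - b) * Ω)
      = 2 * Real.cos ((a - b) / 2 * Ω) * Real.sin ((1 - (a + b) / 2) * Ω) := by
    rw [show (1 - a) * Ω = (1 - (a + b) / 2) * Ω - (a - b) / 2 * Ω by ring,
      show (1 - b) * Ω = (1 - (a + b) / 2) * Ω + (a - b) / 2 * Ω by ring,
      Real.sin_sub, Real.sin_add]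
    ring
  have h₂ : Real.sin (a * Ω) + Real.sin (b * Ω)
      = 2 * Real.cos ((a - b) / 2 * Ω) * Real.sin ((a + b) / 2 * Ω) := by
    rw [show a * Ω = (a + b) / 2 * Ω + (a - b) / 2 * Ω by ring,
      show b * Ω = (a + b) / 2 * Ω - (a - b) / 2 * Ω by ring,
      Real.sin_sub, Real.sin_add]
    ring
  linear_combination (p / Real.sin Ω) * h₁ + (q / Real.sin Ω) * h₂

lemma amgm_sq_eq {x y : ℝ} (hx : 0 ≤ x) (hy : 0 ≤ y) :
    (x ^ 2 + y ^ 2) / 2 + √(x ^ 2 * y ^ 2) = (x + y) ^ 2 / 2 := by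
  rw [← mul_pow, Real.sqrt_sq (mul_nonneg hx hy)]
  ring

/-- Along the SLERP geodesic `w(t)` between two weight vectors on the simplex,
the (AM+GM)/normalise midpoint of `w(a)` and `w(b)` equals `w((a+b)/2)` for any distinct
`a, b ∈ [0,1]`; consequently recursive midpoint bisection by the (AM+GM)/normalise rule,
started from `w(0)` and `w(1)`, produces exactly the dyadic points `w(k/2^d)` of the
geodesic (each bisection step inserts `w((2k+1)/2^(d+1))` between `w(k/2^d)` and
`w((k+1)/2^d)`). -/
theorem amgm_bisection_on_slerp (N : ℕ) (hN : 1 ≤ N) (ws we : Fin N → ℝ)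
    (hws : ∀ i, 0 < ws i) (hws1 : ∑ i, ws i = 1)
    (hwe : ∀ i, 0 < we i) (hwe1 : ∑ i, we i = 1) (hne : ws ≠ we)
    (Ω : ℝ) (hΩ : Ω = Real.arccos (∑ i, Real.sqrt (ws i * we i)))
    (w : ℝ → Fin N → ℝ)
    (hw : ∀ t i, w t i = ((Real.sin ((1 - t) * Ω) * Real.sqrt (ws i)
        + Real.sin (t * Ω) * Real.sqrt (we i)) / Real.sin Ω) ^ 2) :
    (∀ a b : ℝ, a ∈ Set.Icc (0 : ℝ) 1 → b ∈ Set.Icc (0 : ℝ) 1 → a ≠ b →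
      ∀ i : Fin N,
        ((w a i + w b i) / 2 + Real.sqrt (w a i * w b i)) /
            (∑ j, ((w a j + w b j) / 2 + Real.sqrt (w a j * w b j)))
          = w ((a + b) / 2) i) ∧
    (∀ d k : ℕ, k < 2 ^ d →
      ∀ i : Fin N,
        ((w ((k : ℝ) / 2 ^ d) i + w (((k : ℝ) + 1) / 2 ^ d) i) / 2
              + Real.sqrt (w ((k : ℝ) / 2 ^ d) i * w (((k : ℝ) + 1) / 2 ^ d) i)) /
            (∑ j, ((w ((k : ℝ) / 2 ^ d) j + w (((k : ℝ) + 1) / 2 ^ d) j) / 2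
              + Real.sqrt (w ((k : ℝ) / 2 ^ d) j * w (((k : ℝ) + 1) / 2 ^ d) j)))
          = w ((2 * (k : ℝ) + 1) / 2 ^ (d + 1)) i) := by
  have hsum : ∑ i, Real.sqrt (ws i * we i) = ∑ i, √(ws i) * √(we i) :=
    Finset.sum_congr rfl fun i _ => Real.sqrt_mul (hws i).le _
  have hlt : ∑ i, √(ws i) * √(we i) < 1 :=
    sum_sqrt_mul_sqrt_lt_one (fun i => (hws i).le) hws1 (fun i => (hwe i).le) hwe1 hne
  have hnonneg : 0 ≤ ∑ i, √(ws i) * √(we i) := Finset.sum_nonneg fun i _ => by positivity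
  rw [hsum] at hΩ
  have hcos : ∑ i, √(ws i) * √(we i) = Real.cos Ω := by
    rw [hΩ, Real.cos_arccos (by linarith) hlt.le]
  have hΩ0 : 0 < Ω := hΩ ▸ Real.arccos_pos.mpr hlt
  have hΩ1 : Ω ≤ Real.pi / 2 := hΩ ▸ Real.arccos_le_pi_div_two.mpr hnonneg
  have hπ := Real.pi_pos
  have hsin : 0 < Real.sin Ω := Real.sin_pos_of_pos_of_lt_pi hΩ0 (by linarith)
  have hw1 (t : ℝ) : ∑ i, w t i = 1 := by
    simp only [hw]
    exact sum_slerp_sq_eq_one (by simpa only [Real.sq_sqrt (hws _).le] using hws1)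
      (by simpa only [Real.sq_sqrt (hwe _).le] using hwe1) hcos hsin.ne' t
  have hsin_nonneg (t : ℝ) (ht : t ∈ Set.Icc (0 : ℝ) 1) : 0 ≤ Real.sin (t * Ω) :=
    Real.sin_nonneg_of_nonneg_of_le_pi (mul_nonneg ht.1 hΩ0.le) (by nlinarith [ht.1, ht.2])
  have hη (t : ℝ) (ht : t ∈ Set.Icc (0 : ℝ) 1) (i : Fin N) :
      0 ≤ (Real.sin ((1 - t) * Ω) * √(ws i) + Real.sin (t * Ω) * √(we i)) / Real.sin Ω := by
    have h₁ := hsin_nonneg t ht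
    have h₂ := hsin_nonneg (1 - t) ⟨by linarith [ht.2], by linarith [ht.1]⟩
    positivity
  have hmid (a b : ℝ) (ha : a ∈ Set.Icc (0 : ℝ) 1) (hb : b ∈ Set.Icc (0 : ℝ) 1) (i : Fin N) :
      ((w a i + w b i) / 2 + Real.sqrt (w a i * w b i)) /
          (∑ j, ((w a j + w b j) / 2 + Real.sqrt (w a j * w b j)))
        = w ((a + b) / 2) i := by
    have hm (j : Fin N) : (w a j + w b j) / 2 + Real.sqrt (w a j * w b j)
        = 2 * Real.cos ((a - b) / 2 * Ω) ^ 2 * w ((a + b) / 2) j := by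
      rw [hw, hw, hw, amgm_sq_eq (hη a ha j) (hη b hb j), slerp_add_slerp]
      ring
    have hc : 0 < Real.cos ((a - b) / 2 * Ω) :=
      Real.cos_pos_of_mem_Ioo
        ⟨by nlinarith [ha.1, hb.2], by nlinarith [ha.2, hb.1]⟩
    simp only [hm]
    rw [← Finset.mul_sum, hw1, mul_one, mul_div_cancel_left₀ _ (by positivity)]
  refine ⟨fun a b ha hb _ => hmid a b ha hb, fun d k hk i => ?_⟩
  have hpow : (0 : ℝ) < 2 ^ d := by positivity
  have hk' : (k : ℝ) + 1 ≤ 2 ^ d := by exact_mod_cast hk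
  have hk0 : (0 : ℝ) ≤ k := k.cast_nonneg
  rw [hmid _ _ ⟨by positivity, (div_le_one hpow).mpr (by linarith)⟩
    ⟨by positivity, (div_le_one hpow).mpr hk'⟩ i]
  congr 1
  rw [pow_succ]
  field_simp
  ring
end

section
/- Let N ≥ 1, let f ≥ 1, and let η ˢ, η ᵉ : Fin N → ℝ be unit vectors with nonnegative entries and angle Ω = arccos(∑_i η ˢ_i η ᵉ_i). Then for every sequence of unit vectors u₀, u₁, …, u_f : Fin N → ℝ with nonnegative entries, u₀ = η ˢ and u_f = η ᵉ, the sum of squared step angles satisfies ∑_{k=1}^{f} (arccos(∑_i (u_k)_i (u_{k−1})_i))² ≥ Ω²/f, and equality holds for the SLERP points u_k = η(k/f) (when Ω > 0). Consequently, under the leading-order quadratic loss kernel, whose per-step value is (2·step angle)²/2, the f-step SLERP path attains the minimal total loss 2Ω²/f. -/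
/-- The spherical triangle inequality for unit vectors, written with coordinate sums. -/
theorem arccos_sum_mul_le_add {ι : Type*} [Fintype ι] (x y z : ι → ℝ)
    (hx : ∑ i, x i ^ 2 = 1) (hy : ∑ i, y i ^ 2 = 1) (hz : ∑ i, z i ^ 2 = 1) :
    Real.arccos (∑ i, x i * z i) ≤
      Real.arccos (∑ i, x i * y i) + Real.arccos (∑ i, y i * z i) := by
  have key : ∀ v w : ι → ℝ, ∑ i, v i ^ 2 = 1 → ∑ i, w i ^ 2 = 1 →
      InnerProductGeometry.angle (WithLp.toLp 2 v) (WithLp.toLp 2 w) =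
        Real.arccos (∑ i, v i * w i) := by
    intro v w hv hw
    simp [InnerProductGeometry.angle, EuclideanSpace.norm_eq, PiLp.inner_apply, hv, hw, mul_comm]
  rw [← key x z hx hz, ← key x y hx hy, ← key y z hy hz]
  exact InnerProductGeometry.angle_le_angle_add_angle _ _ _

/-- The angle between the endpoints of a path of unit vectors is at most the sum of
the step angles. -/
theorem arccos_le_sum_step_arccos {ι : Type*} [Fintype ι] (u : ℕ → ι → ℝ) (n : ℕ)
    (hu : ∀ k ≤ n, ∑ i, u k i ^ 2 = 1) :
    Real.arccos (∑ i, u n i * u 0 i) ≤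
      ∑ k ∈ Finset.range n, Real.arccos (∑ i, u (k + 1) i * u k i) := by
  induction n with
  | zero =>
    have h0 := hu 0 le_rfl
    simp only [sq] at h0
    simp [h0]
  | succ n ih =>
    rw [Finset.sum_range_succ]
    have htri := arccos_sum_mul_le_add (u (n + 1)) (u n) (u 0) (hu _ le_rfl) (hu _ n.le_succ)
      (hu _ (Nat.zero_le _))
    linarith [ih fun k hk => hu k (hk.trans n.le_succ)]

/-- Points of the spherical interpolation at parameters `a` and `b` have inner product
`cos ((a - b) * Ω)`. -/
theorem sum_slerp_mul_slerp {ι : Type*} [Fintype ι] (x y : ι → ℝ) (Ω : ℝ)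
    (hx : ∑ i, x i ^ 2 = 1) (hy : ∑ i, y i ^ 2 = 1) (hxy : ∑ i, x i * y i = Real.cos Ω)
    (hΩ : Real.sin Ω ≠ 0) (a b : ℝ) :
    ∑ i, (Real.sin ((1 - a) * Ω) * x i + Real.sin (a * Ω) * y i) / Real.sin Ω *
        ((Real.sin ((1 - b) * Ω) * x i + Real.sin (b * Ω) * y i) / Real.sin Ω) =
      Real.cos ((a - b) * Ω) := by
  have bilin : ∀ p q r s d : ℝ, ∑ i, (p * x i + q * y i) / d * ((r * x i + s * y i) / d) =
      (p * r + q * s + (p * s + q * r) * Real.cos Ω) / d ^ 2 := by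
    intro p q r s d
    calc _ = ∑ i, (p * r / d ^ 2 * x i ^ 2 + q * s / d ^ 2 * y i ^ 2 +
          (p * s + q * r) / d ^ 2 * (x i * y i)) :=
          Finset.sum_congr rfl fun i _ => by ring
      _ = _ := by
          rw [Finset.sum_add_distrib, Finset.sum_add_distrib, ← Finset.mul_sum,
            ← Finset.mul_sum, ← Finset.mul_sum, hx, hy, hxy]
          ring
  rw [bilin, div_eq_iff (pow_ne_zero 2 hΩ)]
  simp only [sub_mul, one_mul, Real.sin_sub, Real.cos_sub]
  linear_combination (-Real.sin (a * Ω) * Real.sin (b * Ω)) * Real.sin_sq_add_cos_sq Ω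


/-- Among all `f`-step paths of nonnegative unit vectors from `ηs` to `ηe`,
the sum of squared step angles is at least `Ω²/f`, with equality for the SLERP points
`η(k/f)` (when `Ω > 0`); hence under the leading-order quadratic loss kernel, whose
per-step value is `(2·step angle)²/2`, the `f`-step SLERP path attains the minimal
total loss `2Ω²/f`. -/
theorem slerp_minimises_quadratic_loss (N f : ℕ) (hN : 1 ≤ N) (hf : 1 ≤ f)
    (ηs ηe : Fin N → ℝ)
    (hηs : ∀ i, 0 ≤ ηs i) (hηe : ∀ i, 0 ≤ ηe i)
    (hs1 : ∑ i, ηs i ^ 2 = 1) (he1 : ∑ i, ηe i ^ 2 = 1)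
    (Ω : ℝ) (hΩ : Ω = Real.arccos (∑ i, ηs i * ηe i))
    (η : ℝ → Fin N → ℝ)
    (hη : ∀ t i, η t i
        = (Real.sin ((1 - t) * Ω) * ηs i + Real.sin (t * Ω) * ηe i) / Real.sin Ω) :
    (∀ u : ℕ → Fin N → ℝ,
      (∀ k ≤ f, (∀ i, 0 ≤ u k i) ∧ ∑ i, u k i ^ 2 = 1) →
      u 0 = ηs → u f = ηe →
      Ω ^ 2 / f ≤
        ∑ k ∈ Finset.range f, (Real.arccos (∑ i, u (k + 1) i * u k i)) ^ 2) ∧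
    (0 < Ω →
      ∑ k ∈ Finset.range f,
          (Real.arccos (∑ i, η (((k : ℝ) + 1) / f) i * η ((k : ℝ) / f) i)) ^ 2
        = Ω ^ 2 / f) ∧
    (0 < Ω →
      ∑ k ∈ Finset.range f,
          (2 * Real.arccos (∑ i, η (((k : ℝ) + 1) / f) i * η ((k : ℝ) / f) i)) ^ 2 / 2
        = 2 * Ω ^ 2 / f) := by
  have hf0 : (0 : ℝ) < f := by exact_mod_cast hf
  have step : 0 < Ω → ∀ k : ℕ,
      Real.arccos (∑ i, η (((k : ℝ) + 1) / f) i * η ((k : ℝ) / f) i) = Ω / f := by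
    intro hpos k
    have hle : Ω ≤ Real.pi / 2 := by
      rw [hΩ, Real.arccos_le_pi_div_two]
      exact Finset.sum_nonneg fun i _ => mul_nonneg (hηs i) (hηe i)
    have hsin : Real.sin Ω ≠ 0 :=
      (Real.sin_pos_of_pos_of_lt_pi hpos (by linarith [Real.pi_pos])).ne'
    have hcos : ∑ i, ηs i * ηe i = Real.cos Ω := by
      have hcs := Finset.sum_mul_sq_le_sq_mul_sq Finset.univ ηs ηe
      rw [hs1, he1, one_mul, sq_le_one_iff_abs_le_one, abs_le] at hcs
      rw [hΩ, Real.cos_arccos hcs.1 hcs.2]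
    simp only [hη]
    rw [sum_slerp_mul_slerp ηs ηe Ω hs1 he1 hcos hsin,
      show (((k : ℝ) + 1) / f - k / f) * Ω = Ω / f by ring]
    have hdiv : Ω / f ≤ Ω := div_le_self hpos.le (by exact_mod_cast hf)
    exact Real.arccos_cos (by positivity) (by linarith [Real.pi_pos])
  refine ⟨?_, ?_, ?_⟩
  · intro u hu h0 h1
    have htri := arccos_le_sum_step_arccos u f fun k hk => (hu k hk).2
    have hΩu : Ω = Real.arccos (∑ i, u f i * u 0 i) := by
      simp only [h0, h1, hΩ, mul_comm]
    rw [← hΩu] at htri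
    have hΩ0 : 0 ≤ Ω := hΩ ▸ Real.arccos_nonneg _
    rw [div_le_iff₀' hf0]
    calc Ω ^ 2 ≤ (∑ k ∈ Finset.range f, Real.arccos (∑ i, u (k + 1) i * u k i)) ^ 2 :=
          pow_le_pow_left₀ hΩ0 htri 2
      _ ≤ _ := by
          simpa using sq_sum_le_card_mul_sum_sq (s := Finset.range f)
            (f := fun k => Real.arccos (∑ i, u (k + 1) i * u k i))
  · intro hpos
    simp only [step hpos, Finset.sum_const, Finset.card_range, nsmul_eq_mul]
    field_simp
  · intro hpos
    simp only [step hpos, Finset.sum_const, Finset.card_range, nsmul_eq_mul]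
    field_simp
end

section
/- Let N ≥ 1, let w be a weight vector on the simplex, let Δ : Fin N → ℝ satisfy ∑_i Δ_i = 0 with Δ ≠ 0, and fix t ∈ [0,1]. For s > 0 small enough that w + sΔ is a weight vector on the simplex, let w^SLERP(t; s) denote the SLERP interpolation and let w̆(t; s) denote the (AM+GM)/normalise interpolation, both at parameter t between start weights w and end weights w + sΔ. Then for each component i, lim_{s → 0⁺} (w^SLERP(t; s)_i − w̆(t; s)_i)/s² = 0; that is, the two trajectories agree through second order in the weight change, differing first at third order. -/
open Filter Topology Asymptotics

/-- `HasQuadExpansion f a b c` means `f s = a + b s + c s² + o(s²)` as `s → 0⁺`. -/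
def HasQuadExpansion (f : ℝ → ℝ) (a b c : ℝ) : Prop :=
  Tendsto (fun s => (f s - (a + b * s)) / s ^ 2) (𝓝[>] 0) (𝓝 c)

namespace HasQuadExpansion

variable {f g : ℝ → ℝ} {a b c a' b' c' : ℝ}

theorem congr' (hf : HasQuadExpansion f a b c) (h : f =ᶠ[𝓝[>] 0] g) :
    HasQuadExpansion g a b c := by
  refine Tendsto.congr' ?_ hf
  filter_upwards [h] with s hs
  rw [hs]

theorem congr_coeff (hf : HasQuadExpansion f a b c) (ha : a = a') (hb : b = b') (hc : c = c') :
    HasQuadExpansion f a' b' c' := by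
  rwa [← ha, ← hb, ← hc]

theorem tendsto (hf : HasQuadExpansion f a b c) : Tendsto f (𝓝[>] 0) (𝓝 a) := by
  have hs : Tendsto (fun s : ℝ => s) (𝓝[>] 0) (𝓝 0) :=
    tendsto_nhdsWithin_of_tendsto_nhds tendsto_id
  have h := (Tendsto.mul hf (hs.pow 2)).add ((hs.const_mul b).const_add a)
  have h0 : c * 0 ^ 2 + (a + b * 0) = a := by ring
  rw [h0] at h
  refine h.congr' ?_
  filter_upwards [self_mem_nhdsWithin] with s (hs : 0 < s)
  field_simp
  ring

theorem const (a : ℝ) : HasQuadExpansion (fun _ => a) a 0 0 := by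
  simp [HasQuadExpansion]

theorem add (hf : HasQuadExpansion f a b c) (hg : HasQuadExpansion g a' b' c') :
    HasQuadExpansion (fun s => f s + g s) (a + a') (b + b') (c + c') :=
  (Tendsto.add hf hg).congr fun s => by ring

theorem mul (hf : HasQuadExpansion f a b c) (hg : HasQuadExpansion g a' b' c') :
    HasQuadExpansion (fun s => f s * g s) (a * a') (a * b' + b * a')
      (a * c' + b * b' + c * a') := by
  have hs : Tendsto (fun s : ℝ => s) (𝓝[>] 0) (𝓝 0) :=
    tendsto_nhdsWithin_of_tendsto_nhds tendsto_id
  have h := ((hf.tendsto.mul hg).add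
    (((hs.const_mul b').const_add a').mul hf)).add_const (b * b')
  have h0 : a * c' + (a' + b' * 0) * c + b * b' = a * c' + b * b' + c * a' := by ring
  rw [h0] at h
  refine h.congr' ?_
  filter_upwards [self_mem_nhdsWithin] with s (hs : 0 < s)
  field_simp
  ring

theorem const_mul (k : ℝ) (hf : HasQuadExpansion f a b c) :
    HasQuadExpansion (fun s => k * f s) (k * a) (k * b) (k * c) := by
  simpa using (const k).mul hf

theorem sub (hf : HasQuadExpansion f a b c) (hg : HasQuadExpansion g a' b' c') :
    HasQuadExpansion (fun s => f s - g s) (a - a') (b - b') (c - c') :=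
  (Tendsto.sub hf hg).congr fun s => by ring

theorem sum {ι : Type*} (u : Finset ι) {f : ι → ℝ → ℝ} {a b c : ι → ℝ}
    (h : ∀ j ∈ u, HasQuadExpansion (f j) (a j) (b j) (c j)) :
    HasQuadExpansion (fun s => ∑ j ∈ u, f j s) (∑ j ∈ u, a j) (∑ j ∈ u, b j) (∑ j ∈ u, c j) := by
  refine (tendsto_finsetSum u h).congr fun s => ?_
  rw [← Finset.sum_div, Finset.sum_sub_distrib, Finset.sum_add_distrib, Finset.sum_mul]

theorem one_add_mul_rpow (p x : ℝ) :
    HasQuadExpansion (fun s => (1 + s * x) ^ p) 1 (p * x) (p * (p - 1) / 2 * x ^ 2) := by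
  have h := (Real.one_add_rpow_hasFPowerSeriesAt_zero (a := p)).isBigO_sub_partialSum_pow 3
  have hx : Tendsto (fun s : ℝ => s * x) (𝓝[>] 0) (𝓝 0) := by
    refine tendsto_nhdsWithin_of_tendsto_nhds ?_
    simpa using (tendsto_id (x := 𝓝 (0 : ℝ))).mul_const x
  have hchoose : Ring.choose p 2 = p * (p - 1) / 2 := by
    rw [Ring.choose_eq_smul]
    simp [descPochhammer, Polynomial.smeval_mul, Polynomial.smeval_X,
      Polynomial.smeval_sub]
    ring
  have h2 := h.comp_tendsto hx
  have h3 : (fun s : ℝ => (1 + s * x) ^ p - (1 + p * x * s + p * (p - 1) / 2 * x ^ 2 * s ^ 2))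
      =O[𝓝[>] 0] fun s => s ^ 3 := by
    have h6 : ((fun y : ℝ => ‖y‖ ^ 3) ∘ fun s => s * x) =O[𝓝[>] 0] fun s => s ^ 3 := by
      refine IsBigO.of_bound (|x| ^ 3) (Eventually.of_forall fun s => ?_)
      simp [mul_pow, mul_comm]
    refine (h2.trans h6).congr_left fun s => ?_
    simp [FormalMultilinearSeries.partialSum, Finset.sum_range_succ, binomialSeries,
      hchoose]
    ring
  have h4 : (fun s : ℝ => s ^ 3) =o[𝓝[>] 0] fun s => s ^ 2 :=
    (isLittleO_pow_pow (by norm_num)).mono nhdsWithin_le_nhds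
  have h5 := ((h3.trans_isLittleO h4).tendsto_div_nhds_zero).add_const (p * (p - 1) / 2 * x ^ 2)
  rw [zero_add] at h5
  refine h5.congr' ?_
  filter_upwards [self_mem_nhdsWithin] with s (hs : 0 < s)
  field_simp
  ring

end HasQuadExpansion

theorem tendsto_one_sub_cos_div_sq :
    Tendsto (fun θ : ℝ => (1 - Real.cos θ) / θ ^ 2) (𝓝[≠] 0) (𝓝 (1 / 2)) := by
  have h : (fun θ : ℝ => Real.cos θ - (1 - θ ^ 2 / 2)) =O[𝓝[≠] 0] fun θ => θ ^ 4 := by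
    refine IsBigO.of_bound (5 / 96) (Eventually.filter_mono nhdsWithin_le_nhds ?_)
    filter_upwards [Metric.closedBall_mem_nhds (0 : ℝ) one_pos] with θ hθ
    simpa [mul_comm] using Real.cos_bound (x := θ) (by simpa using hθ)
  have h' : (fun θ : ℝ => θ ^ 4) =o[𝓝[≠] 0] fun θ => θ ^ 2 :=
    (isLittleO_pow_pow (by norm_num)).mono nhdsWithin_le_nhds
  have h2 := ((h.trans_isLittleO h').tendsto_div_nhds_zero).const_sub (1 / 2)
  rw [sub_zero] at h2
  refine h2.congr' ?_
  filter_upwards [self_mem_nhdsWithin] with θ (hθ : θ ≠ 0)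
  field_simp
  ring

theorem isLittleO_sin_mul_sub (k : ℝ) :
    (fun θ : ℝ => Real.sin (k * θ) - (k * θ - (k * θ) ^ 3 / 6)) =o[𝓝[≠] 0] fun θ => θ ^ 3 := by
  have hk : Tendsto (fun θ : ℝ => k * θ) (𝓝[≠] 0) (𝓝 0) := by
    refine tendsto_nhdsWithin_of_tendsto_nhds ?_
    simpa using (tendsto_id (x := 𝓝 (0 : ℝ))).const_mul k
  have h : (fun θ : ℝ => Real.sin (k * θ) - (k * θ - (k * θ) ^ 3 / 6))
      =O[𝓝[≠] 0] fun θ => θ ^ 5 := by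
    refine IsBigO.of_bound (|k| ^ 5 / 100) ?_
    filter_upwards [hk.eventually (Metric.closedBall_mem_nhds (0 : ℝ) one_pos)] with θ hθ
    refine (Real.sin_bound (x := k * θ) (by simpa using hθ)).trans_eq ?_
    rw [Real.norm_eq_abs, abs_mul, abs_pow]
    ring
  exact h.trans_isLittleO ((isLittleO_pow_pow (by norm_num)).mono nhdsWithin_le_nhds)

theorem tendsto_sin_mul_div_sin_sub (k : ℝ) :
    Tendsto (fun θ : ℝ => (Real.sin (k * θ) / Real.sin θ - k) / θ ^ 2) (𝓝[≠] 0)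
      (𝓝 (k * (1 - k ^ 2) / 6)) := by
  have h1 := (isLittleO_sin_mul_sub k).tendsto_div_nhds_zero
  have h2 := (isLittleO_sin_mul_sub 1).tendsto_div_nhds_zero
  have hθ : Tendsto (fun θ : ℝ => θ) (𝓝[≠] 0) (𝓝 0) :=
    tendsto_nhdsWithin_of_tendsto_nhds tendsto_id
  have h3 : Tendsto (fun θ : ℝ => Real.sin θ / θ) (𝓝[≠] 0) (𝓝 1) := by
    have h := ((h2.mul (hθ.pow 2)).add_const 1).sub ((hθ.pow 2).div_const 6)
    norm_num at h
    refine h.congr' ?_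
    filter_upwards [self_mem_nhdsWithin] with θ (hθ : θ ≠ 0)
    field_simp
    ring
  have h4 := ((h1.sub (h2.const_mul k)).add_const (k * (1 - k ^ 2) / 6)).div h3 one_ne_zero
  rw [show (0 - k * 0 + k * (1 - k ^ 2) / 6) / 1 = k * (1 - k ^ 2) / 6 by ring] at h4
  refine h4.congr' ?_
  filter_upwards [self_mem_nhdsWithin, h3.eventually_ne one_ne_zero] with θ (hθ : θ ≠ 0) hs
  have : Real.sin θ ≠ 0 := fun h => hs (by simp [h])
  simp only [one_mul, Pi.div_apply]
  field_simp
  ring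

theorem tendsto_arccos_of_tendsto_one {f : ℝ → ℝ} {B : ℝ} (hB : 0 < B)
    (hf : HasQuadExpansion f 1 0 (-B)) :
    Tendsto (fun s => Real.arccos (f s)) (𝓝[>] 0) (𝓝[≠] 0) ∧
      Tendsto (fun s => Real.arccos (f s) ^ 2 / s ^ 2) (𝓝[>] 0) (𝓝 (2 * B)) := by
  have hlt : ∀ᶠ s in 𝓝[>] (0 : ℝ), f s < 1 := by
    filter_upwards [Tendsto.eventually_lt_const (neg_lt_zero.2 hB) hf, self_mem_nhdsWithin]
      with s hs (h0 : 0 < s)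
    by_contra! h
    exact absurd hs (not_lt.2 (div_nonneg (by linarith) (by positivity)))
  have hpos : ∀ᶠ s in 𝓝[>] (0 : ℝ), 0 < f s := hf.tendsto.eventually_const_lt one_pos
  have hne : Tendsto (fun s => Real.arccos (f s)) (𝓝[>] 0) (𝓝[≠] 0) := by
    refine tendsto_nhdsWithin_iff.2 ⟨?_, ?_⟩
    · simpa [Function.comp_def] using (Real.continuous_arccos.tendsto 1).comp hf.tendsto
    · filter_upwards [hlt] with s hs
      exact (Real.arccos_pos.2 hs).ne'
  refine ⟨hne, ?_⟩
  have h := (Tendsto.neg hf).div (tendsto_one_sub_cos_div_sq.comp hne) (by norm_num)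
  rw [show - -B / (1 / 2) = 2 * B by ring] at h
  refine h.congr' ?_
  filter_upwards [hlt, hpos, self_mem_nhdsWithin] with s h1 h2 (h0 : 0 < s)
  have ha : Real.arccos (f s) ≠ 0 := (Real.arccos_pos.2 h1).ne'
  have h3 : 1 - f s ≠ 0 := by linarith
  simp only [Pi.div_apply, Function.comp_apply, Real.cos_arccos (by linarith : -1 ≤ f s) h1.le]
  field_simp
  ring

theorem HasQuadExpansion.sin_mul_arccos_div {f : ℝ → ℝ} {B : ℝ} (hB : 0 < B)
    (hf : HasQuadExpansion f 1 0 (-B)) (k : ℝ) :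
    HasQuadExpansion (fun s => Real.sin (k * Real.arccos (f s)) / Real.sin (Real.arccos (f s)))
      k 0 (k * (1 - k ^ 2) / 3 * B) := by
  obtain ⟨h1, h2⟩ := tendsto_arccos_of_tendsto_one hB hf
  have h := ((tendsto_sin_mul_div_sin_sub k).comp h1).mul h2
  rw [show k * (1 - k ^ 2) / 6 * (2 * B) = k * (1 - k ^ 2) / 3 * B by ring] at h
  refine h.congr' ?_
  filter_upwards [(tendsto_nhdsWithin_iff.1 h1).2] with s (hs : _ ≠ 0)
  simp only [Function.comp_apply, zero_mul, add_zero]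
  field_simp

theorem eventually_one_add_mul_pos (x : ℝ) : ∀ᶠ s in 𝓝[>] (0 : ℝ), 0 < 1 + s * x := by
  have h : Tendsto (fun s : ℝ => 1 + s * x) (𝓝 0) (𝓝 1) := by
    simpa using ((tendsto_id (x := 𝓝 (0 : ℝ))).mul_const x).const_add 1
  exact (tendsto_nhdsWithin_of_tendsto_nhds h).eventually_const_lt one_pos

section Weights

variable {v d : ℝ}

theorem HasQuadExpansion.sqrt_add_mul (hv : 0 < v) :
    HasQuadExpansion (fun s => √(v + s * d)) (√v) (√v * (d / v) / 2) (-√v * (d / v) ^ 2 / 8) := by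
  have h := (one_add_mul_rpow (1 / 2) (d / v)).const_mul √v
  convert h using 1
  · funext s
    rw [← Real.sqrt_eq_rpow, ← Real.sqrt_mul hv.le]
    congr 1
    field_simp
  all_goals ring

theorem HasQuadExpansion.sqrt_mul_add_mul (hv : 0 < v) :
    HasQuadExpansion (fun s => √(v * (v + s * d))) v (d / 2) (-(d ^ 2 / v / 8)) := by
  have h := (sqrt_add_mul (d := d) hv).const_mul √v
  have hs := Real.mul_self_sqrt hv.le
  convert h using 1
  · funext s
    rw [Real.sqrt_mul hv.le]
  · exact hs.symm
  · rw [show √v * (√v * (d / v) / 2) = √v * √v * (d / v) / 2 by ring, hs]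
    field_simp
  · rw [show √v * (-√v * (d / v) ^ 2 / 8) = -(√v * √v) * (d / v) ^ 2 / 8 by ring, hs]
    field_simp

theorem HasQuadExpansion.arith_add_geom (hv : 0 < v) (t : ℝ) :
    HasQuadExpansion (fun s => (1 - t) * v + t * (v + s * d) + v ^ (1 - t) * (v + s * d) ^ t)
      (2 * v) (2 * t * d) (-(t * (1 - t) / 2) * (d ^ 2 / v)) := by
  have hlin : HasQuadExpansion (fun s => (1 - t) * v + t * (v + s * d)) v (t * d) 0 := by
    refine tendsto_const_nhds.congr fun s => ?_
    ring
  have h := hlin.add ((one_add_mul_rpow t (d / v)).const_mul v)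
  have h' : HasQuadExpansion (fun s => (1 - t) * v + t * (v + s * d) + v * (1 + s * (d / v)) ^ t)
      (2 * v) (2 * t * d) (-(t * (1 - t) / 2) * (d ^ 2 / v)) := by
    convert h using 1 <;> field_simp <;> ring
  refine h'.congr' ?_
  filter_upwards [eventually_one_add_mul_pos (d / v)] with s hs
  have e : v + s * d = v * (1 + s * (d / v)) := by field_simp
  have e2 : v ^ (1 - t) * (v + s * d) ^ t = v * (1 + s * (d / v)) ^ t := by
    rw [e, Real.mul_rpow hv.le hs.le, ← mul_assoc, ← Real.rpow_add hv, sub_add_cancel,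
      Real.rpow_one]
  rw [e2]

end Weights

/-- For a weight vector `w` on the simplex and a nonzero displacement `Δ` with
`∑ i, Δ i = 0`, and for fixed `t ∈ [0,1]`, the SLERP interpolation and the
(AM+GM)/normalise interpolation between `w` and `w + s·Δ` agree through second order in
the weight change: for each component `i`,
`(w^SLERP(t;s)_i − w̆(t;s)_i)/s² → 0` as `s → 0⁺`. -/
theorem slerp_amgm_second_order_agreement (N : ℕ) (hN : 1 ≤ N) (w Δ : Fin N → ℝ)
    (hw : ∀ i, 0 < w i) (hw1 : ∑ i, w i = 1)
    (hΔ0 : ∑ i, Δ i = 0) (hΔ : Δ ≠ 0)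
    (t : ℝ) (ht : t ∈ Set.Icc (0 : ℝ) 1) (i : Fin N) :
    Filter.Tendsto (fun s : ℝ =>
      (((Real.sin ((1 - t) * Real.arccos (∑ j, Real.sqrt (w j * (w j + s * Δ j))))
            * Real.sqrt (w i)
          + Real.sin (t * Real.arccos (∑ j, Real.sqrt (w j * (w j + s * Δ j))))
            * Real.sqrt (w i + s * Δ i))
          / Real.sin (Real.arccos (∑ j, Real.sqrt (w j * (w j + s * Δ j))))) ^ 2
        - ((1 - t) * w i + t * (w i + s * Δ i) + w i ^ (1 - t) * (w i + s * Δ i) ^ t) /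
            ∑ j, ((1 - t) * w j + t * (w j + s * Δ j) + w j ^ (1 - t) * (w j + s * Δ j) ^ t))
      / s ^ 2)
      (nhdsWithin 0 (Set.Ioi 0)) (nhds 0) := by
  set A := ∑ j, Δ j ^ 2 / w j
  have hApos : 0 < A := by
    obtain ⟨j, hj⟩ := Function.ne_iff.1 hΔ
    have hj' : Δ j ≠ 0 := hj
    exact Finset.sum_pos' (fun k _ => div_nonneg (sq_nonneg _) (hw k).le)
      ⟨j, Finset.mem_univ j, div_pos (by positivity) (hw j)⟩
  have hcos : HasQuadExpansion (fun s => ∑ j, √(w j * (w j + s * Δ j))) 1 0 (-(A / 8)) := by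
    have h := HasQuadExpansion.sum Finset.univ fun j _ =>
      HasQuadExpansion.sqrt_mul_add_mul (d := Δ j) (hw j)
    rwa [hw1, ← Finset.sum_div, hΔ0, zero_div, Finset.sum_neg_distrib, ← Finset.sum_div] at h
  have hsum : HasQuadExpansion
      (fun s => ∑ j, ((1 - t) * w j + t * (w j + s * Δ j) + w j ^ (1 - t) * (w j + s * Δ j) ^ t))
      2 0 (-(t * (1 - t) / 2) * A) := by
    have h := HasQuadExpansion.sum Finset.univ fun j _ =>
      HasQuadExpansion.arith_add_geom (d := Δ j) (hw j) t
    rwa [← Finset.mul_sum, hw1, ← Finset.mul_sum, hΔ0, ← Finset.mul_sum, mul_one, mul_zero] at h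
  have hη := ((hcos.sin_mul_arccos_div (by positivity) (1 - t)).mul (.const √(w i))).add
    ((hcos.sin_mul_arccos_div (by positivity) t).mul (.sqrt_add_mul (d := Δ i) (hw i)))
  obtain ⟨r, hr⟩ : ∃ r, √(w i) = r := ⟨_, rfl⟩
  have hr2 : w i = r ^ 2 := by rw [← hr, Real.sq_sqrt (hw i).le]
  have hr0 : r ≠ 0 := by
    rintro rfl
    exact (hw i).ne' (by simpa using hr2)
  have hdiff := ((hη.mul hη).mul hsum).sub (.arith_add_geom (d := Δ i) (hw i) t) |>.congr_coeff
    (a' := 0) (b' := 0) (c' := 0) (by rw [hr, hr2]; ring) (by rw [hr, hr2]; field_simp; ring)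
    (by rw [hr, hr2]; field_simp; ring)
  have hzero := Tendsto.div hdiff hsum.tendsto two_ne_zero
  rw [zero_div] at hzero
  refine hzero.congr' ?_
  filter_upwards [hsum.tendsto.eventually_ne two_ne_zero, self_mem_nhdsWithin]
    with s hs (h0 : 0 < s)
  simp only [Pi.div_apply]
  generalize ∑ j, ((1 - t) * w j + t * (w j + s * Δ j) + w j ^ (1 - t) * (w j + s * Δ j) ^ t)
    = S at hs ⊢
  rw [add_div (Real.sin _ * _), mul_div_right_comm (Real.sin _),
    mul_div_right_comm (Real.sin (t * _))]
  generalize _ + _ * √(w i + s * Δ i) = η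
  generalize _ + _ * (w i + s * Δ i) ^ t = p
  field_simp
  ring
end

section
/- Let N ≥ 1, let ε > 0, and let wˢ, wᵉ be weight vectors on the simplex with wˢ ≠ wᵉ and min_i wˢ_i ≥ ε, min_i wᵉ_i ≥ ε. Let Ω = arccos(∑_i √(wˢ_i wᵉ_i)), and suppose every point of the f-step SLERP path w(k/f) (k = 0,…,f) has all components ≥ ε. Let C_SLERP(f) = ∑_{k=1}^{f} D_KL(w(k/f) ‖ w((k−1)/f)) and let C_*(f) be the infimum of ∑_{k=1}^{f} D_KL(w^{(k)} ‖ w^{(k−1)}) over all sequences of weight vectors w^{(0)}, …, w^{(f)} on the simplex with w^{(0)} = wˢ, w^{(f)} = wᵉ, and min_i w^{(k)}_i ≥ ε for all k. Then for every integer f ≥ 4Ω/ε, one has 0 ≤ C_SLERP(f) − C_*(f) ≤ (86·N/ε⁴) · Ω⁴ / f³. -/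
open Finset in
/-- A sequence starting at `0` is controlled by its discrete Dirichlet energy. -/
lemma sq_le_mul_sum_sq_sub (e : ℕ → ℝ) (h0 : e 0 = 0) {f k : ℕ} (hk : k ≤ f) :
    e k ^ 2 ≤ f * ∑ j ∈ range f, (e (j + 1) - e j) ^ 2 := by
  have h1 : e k = ∑ j ∈ range k, (e (j + 1) - e j) := by
    rw [sum_range_sub, h0, sub_zero]
  have h2 := sq_sum_le_card_mul_sum_sq (s := range k) (f := fun j => e (j + 1) - e j)
  rw [← h1, card_range] at h2
  have h3 : ∑ j ∈ range k, (e (j + 1) - e j) ^ 2 ≤ ∑ j ∈ range f, (e (j + 1) - e j) ^ 2 :=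
    sum_le_sum_of_subset_of_nonneg (range_subset_range.2 hk) fun _ _ _ => sq_nonneg _
  have h4 : (k : ℝ) ≤ f := by exact_mod_cast hk
  exact h2.trans (mul_le_mul h4 h3 (sum_nonneg fun _ _ => sq_nonneg _) (Nat.cast_nonneg f))

/-- Scalar Kullback–Leibler terms dominate the squared distance on a bounded range. -/
lemma sq_sub_le_kl {ε r s : ℝ} (hε : 0 < ε) (hr : 0 < r) (hs : 0 < s)
    (hr1 : r * ε ≤ 1) (hs1 : s * ε ≤ 1) :
    ε / 4 * (r - s) ^ 2 ≤ r * Real.log (r / s) - r + s := by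
  obtain ⟨a, ha, rfl⟩ : ∃ a, 0 < a ∧ r = a ^ 2 :=
    ⟨√r, Real.sqrt_pos.2 hr, (Real.sq_sqrt hr.le).symm⟩
  obtain ⟨b, hb, rfl⟩ : ∃ b, 0 < b ∧ s = b ^ 2 :=
    ⟨√s, Real.sqrt_pos.2 hs, (Real.sq_sqrt hs.le).symm⟩
  have h1 : Real.log (a ^ 2 / b ^ 2) = 2 * Real.log (a / b) := by
    rw [← div_pow, Real.log_pow]; norm_num
  have h2 : 1 - (a / b)⁻¹ ≤ Real.log (a / b) :=
    Real.one_sub_inv_le_log_of_pos (div_pos ha hb)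
  have h3 : a ^ 2 * (2 * (1 - (a / b)⁻¹)) ≤ a ^ 2 * (2 * Real.log (a / b)) := by gcongr
  have h4 : a ^ 2 * (2 * (1 - (a / b)⁻¹)) = 2 * a ^ 2 - 2 * (a * b) := by
    field_simp
  have h5 : (a - b) ^ 2 ≤ a ^ 2 * Real.log (a ^ 2 / b ^ 2) - a ^ 2 + b ^ 2 := by
    rw [h1]; linarith
  refine le_trans ?_ h5
  have h6 : ε * (a + b) ^ 2 ≤ 4 := by nlinarith [mul_nonneg hε.le (sq_nonneg (a - b))]
  have h7 : ε / 4 * (a ^ 2 - b ^ 2) ^ 2 = (ε * (a + b) ^ 2) / 4 * (a - b) ^ 2 := by ring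
  rw [h7]
  nlinarith [sq_nonneg (a - b)]

open Finset in
/-- The Kullback–Leibler divergence between positive vectors of equal mass is nonnegative. -/
lemma sum_mul_log_div_nonneg {ι : Type*} [Fintype ι] {p q : ι → ℝ} (hp : ∀ i, 0 < p i)
    (hq : ∀ i, 0 < q i) (h : ∑ i, p i = ∑ i, q i) :
    0 ≤ ∑ i, p i * Real.log (p i / q i) := by
  have h1 : ∑ i, (p i - q i) ≤ ∑ i, p i * Real.log (p i / q i) := by
    refine sum_le_sum fun i _ => ?_
    have h2 := mul_le_mul_of_nonneg_left
      (Real.one_sub_inv_le_log_of_pos (div_pos (hp i) (hq i))) (hp i).le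
    have h3 : p i * (1 - (p i / q i)⁻¹) = p i - q i := by
      have := (hp i).ne'
      have := (hq i).ne'
      field_simp
    linarith
  rwa [sum_sub_distrib, h, sub_self] at h1

/-- First-order expansion of `p * log (p / q)` with a quadratic remainder. -/
lemma bregman_lower_bound {ε p q p' q' : ℝ} (hε : 0 < ε) (hp : ε ≤ p) (hq : ε ≤ q)
    (hp' : ε ≤ p') (hq' : ε ≤ q') (hp1 : p ≤ 1) (hq1 : q ≤ 1) :
    ε ^ 2 / 4 * ((p - p') / p' - (q - q') / q') ^ 2
      + (Real.log (p' / q') + 1) * (p - p') - p' / q' * (q - q')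
      ≤ p * Real.log (p / q) - p' * Real.log (p' / q') := by
  have p0 : 0 < p := hε.trans_le hp
  have q0 : 0 < q := hε.trans_le hq
  have p0' : 0 < p' := hε.trans_le hp'
  have q0' : 0 < q' := hε.trans_le hq'
  have hr : p / p' * ε ≤ 1 := by
    rw [div_mul_eq_mul_div, div_le_one p0']; nlinarith
  have hs : q / q' * ε ≤ 1 := by
    rw [div_mul_eq_mul_div, div_le_one q0']; nlinarith
  have h1 := sq_sub_le_kl hε (div_pos p0 p0') (div_pos q0 q0') hr hs
  have h2 : (p - p') / p' - (q - q') / q' = p / p' - q / q' := by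
    field_simp
    ring
  have h3 : Real.log (p / p' / (q / q')) = Real.log (p / q) - Real.log (p' / q') := by
    rw [← Real.log_div (by positivity) (by positivity)]
    congr 1
    field_simp
  rw [h3] at h1
  have h0 : 0 ≤ ε / 4 * (p / p' - q / q') ^ 2 := by positivity
  have h4 : ε * (ε / 4 * (p / p' - q / q') ^ 2) ≤
      p' * (p / p' * (Real.log (p / q) - Real.log (p' / q')) - p / p' + q / q') :=
    (mul_le_mul_of_nonneg_right hp' h0).trans (mul_le_mul_of_nonneg_left h1 p0'.le)
  have h5 : p' * (p / p' * (Real.log (p / q) - Real.log (p' / q')) - p / p' + q / q')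
      = p * (Real.log (p / q) - Real.log (p' / q')) - p + p' / q' * q := by
    field_simp
  have h6 : p' / q' * (q - q') = p' / q' * q - p' := by
    field_simp
  rw [h5] at h4
  rw [h2, h6]
  linarith

open Finset in
/-- If the stationarity residual of the path cost at `w` is at most `B`, up to a constant `c`
common to all coordinates and times, then `w` is nearly optimal. -/
lemma cost_sub_le_of_residual {N f : ℕ} (hf : 0 < f) {ε B c : ℝ} (hε : 0 < ε)
    (w v : ℕ → Fin N → ℝ)
    (hw : ∀ k ≤ f, ∀ i, ε ≤ w k i) (hw1 : ∀ k ≤ f, ∑ i, w k i = 1)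
    (hv : ∀ k ≤ f, ∀ i, ε ≤ v k i) (hv1 : ∀ k ≤ f, ∑ i, v k i = 1)
    (h0 : v 0 = w 0) (h1 : v f = w f)
    (hB : ∀ k, 0 < k → k < f → ∀ i,
      |Real.log (w k i / w (k - 1) i) + 1 + c - w (k + 1) i / w k i| * w k i ≤ B) :
    (∑ k ∈ range f, ∑ i, w (k + 1) i * Real.log (w (k + 1) i / w k i))
      - ∑ k ∈ range f, ∑ i, v (k + 1) i * Real.log (v (k + 1) i / v k i)
      ≤ N * (B ^ 2 * f ^ 3 / ε ^ 2) := by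
  have hfR : (0 : ℝ) < f := by exact_mod_cast hf
  set e : ℕ → Fin N → ℝ := fun k i => (v k i - w k i) / w k i with he
  set G : ℕ → Fin N → ℝ := fun k i => Real.log (w k i / w (k - 1) i) + 1 + c with hG
  have hv_le : ∀ k ≤ f, ∀ i, v k i ≤ 1 := fun k hk i => by
    rw [← hv1 k hk]
    exact single_le_sum (fun j _ => hε.le.trans (hv k hk j)) (mem_univ i)
  have hstep : ∀ k ∈ range f,
      ∑ i, (ε ^ 2 / 4 * (e (k + 1) i - e k i) ^ 2 + G (k + 1) i * (v (k + 1) i - w (k + 1) i)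
        - w (k + 1) i / w k i * (v k i - w k i))
      ≤ (∑ i, v (k + 1) i * Real.log (v (k + 1) i / v k i))
        - ∑ i, w (k + 1) i * Real.log (w (k + 1) i / w k i) := by
    intro k hk
    have hk' : k + 1 ≤ f := mem_range.1 hk
    have hk'' : k ≤ f := by omega
    have hz : ∑ i, c * (v (k + 1) i - w (k + 1) i) = 0 := by
      rw [← mul_sum, sum_sub_distrib, hv1 _ hk', hw1 _ hk']; simp
    rw [← sum_sub_distrib, ← sub_zero (∑ i, (_ - _ : ℝ)), ← hz, ← sum_sub_distrib]
    refine sum_le_sum fun i _ => ?_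
    have := bregman_lower_bound hε (hv _ hk' i) (hv _ hk'' i) (hw _ hk' i) (hw _ hk'' i)
      (hv_le _ hk' i) (hv_le _ hk'' i)
    simp only [hG, he, Nat.add_sub_cancel]
    linarith
  have hcoord : ∀ i, -(B ^ 2 * f ^ 3 / ε ^ 2) ≤
      ∑ k ∈ range f, (ε ^ 2 / 4 * (e (k + 1) i - e k i) ^ 2
        + G (k + 1) i * (v (k + 1) i - w (k + 1) i)
        - w (k + 1) i / w k i * (v k i - w k i)) := by
    intro i
    set D := ∑ k ∈ range f, (e (k + 1) i - e k i) ^ 2 with hD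
    have hshift : ∑ k ∈ range f, (G (k + 1) i * (v (k + 1) i - w (k + 1) i)
        - G k i * (v k i - w k i)) = 0 := by
      rw [sum_range_sub (fun k => G k i * (v k i - w k i)), h0, h1]; simp
    have hsplit : ∑ k ∈ range f, (ε ^ 2 / 4 * (e (k + 1) i - e k i) ^ 2
        + G (k + 1) i * (v (k + 1) i - w (k + 1) i)
        - w (k + 1) i / w k i * (v k i - w k i))
        = ε ^ 2 / 4 * D + ∑ k ∈ range f, (G k i - w (k + 1) i / w k i) * (v k i - w k i) := by
      rw [hD, mul_sum, ← sum_add_distrib, ← sub_eq_zero, ← sum_sub_distrib, ← hshift]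
      exact sum_congr rfl fun k _ => by ring
    have hlin : ∀ k ∈ range f, -(ε ^ 2 / 4 * D / f + B ^ 2 * f ^ 2 / ε ^ 2)
        ≤ (G k i - w (k + 1) i / w k i) * (v k i - w k i) := by
      intro k hk
      have hkf : k < f := mem_range.1 hk
      have hD0 : 0 ≤ D := sum_nonneg fun _ _ => sq_nonneg _
      rcases Nat.eq_zero_or_pos k with rfl | hk0
      · rw [h0]
        have : 0 ≤ ε ^ 2 / 4 * D / f + B ^ 2 * f ^ 2 / ε ^ 2 := by positivity
        rw [sub_self, mul_zero]
        linarith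
      · have hwk : 0 < w k i := hε.trans_le (hw k hkf.le i)
        have he2 : e k i ^ 2 ≤ f * D :=
          sq_le_mul_sum_sq_sub (fun k => e k i) (by simp [he, h0]) hkf.le
        have hve : v k i - w k i = w k i * e k i := by simp only [he]; field_simp
        have habs : |(G k i - w (k + 1) i / w k i) * (v k i - w k i)| ≤ B * |e k i| := by
          rw [hve, ← mul_assoc, abs_mul, abs_mul, abs_of_pos hwk]
          exact mul_le_mul_of_nonneg_right (hB k hk0 hkf i) (abs_nonneg _)
        have hyoung : B * |e k i| ≤ ε ^ 2 / 4 * (e k i ^ 2 / f ^ 2) + B ^ 2 * f ^ 2 / ε ^ 2 := by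
          have h2 := sq_nonneg (ε / 2 * (|e k i| / f) - B * f / ε)
          have h3 : (ε / 2 * (|e k i| / f) - B * f / ε) ^ 2
              = ε ^ 2 / 4 * (|e k i| ^ 2 / f ^ 2) + B ^ 2 * f ^ 2 / ε ^ 2 - B * |e k i| := by
            field_simp
            ring
          rw [h3, sq_abs] at h2
          linarith
        have hdiv : e k i ^ 2 / f ^ 2 ≤ D / f := by
          rw [div_le_div_iff₀ (by positivity) hfR]
          nlinarith
        have := mul_le_mul_of_nonneg_left hdiv (by positivity : 0 ≤ ε ^ 2 / 4)
        rw [← mul_div_assoc (ε ^ 2 / 4) D] at this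
        linarith [neg_le_of_abs_le habs]
    have hsum := sum_le_sum hlin
    rw [sum_const, card_range, nsmul_eq_mul] at hsum
    have hmul : (f : ℝ) * -(ε ^ 2 / 4 * D / f + B ^ 2 * f ^ 2 / ε ^ 2)
        = -(ε ^ 2 / 4 * D) - B ^ 2 * f ^ 3 / ε ^ 2 := by
      field_simp
      ring
    rw [hsplit]
    linarith
  have hA := sum_le_sum hstep
  rw [sum_comm, sum_sub_distrib] at hA
  have hC := sum_le_sum fun i (_ : i ∈ (univ : Finset (Fin N))) => hcoord i
  rw [sum_const, card_univ, Fintype.card_fin, nsmul_eq_mul] at hC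
  linarith

/-- Stationarity residual along a great circle, in one coordinate: `x` is the coordinate,
`y` the coordinate of the unit velocity and `θ` the step angle. -/
lemma slerp_residual_bound {ε x y θ : ℝ} (hε1 : ε ≤ 1 / 2) (hx : 0 < x) (hx1 : x ≤ 1)
    (hxε : ε ≤ x ^ 2) (hy : |y| ≤ 1) (hθ : 0 < θ) (hθε : θ ≤ ε / 4) :
    |Real.log (x ^ 2 / (x * Real.cos θ - y * Real.sin θ) ^ 2) + 1
        + (Real.log (Real.cos θ ^ 2) + Real.cos θ ^ 2 - 1)
        - (x * Real.cos θ + y * Real.sin θ) ^ 2 / x ^ 2| * x ^ 2 ≤ 5 * θ ^ 3 / ε := by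
  have hε : 0 < ε := by linarith
  set C := Real.cos θ with hCdef
  set S := Real.sin θ with hSdef
  have hS : S ≤ θ := Real.sin_le hθ.le
  have hS0 : 0 ≤ S := Real.sin_nonneg_of_nonneg_of_le_pi hθ.le (by linarith [Real.pi_gt_three])
  have hC : 127 / 128 ≤ C := by
    have := Real.one_sub_sq_div_two_le_cos (x := θ)
    nlinarith
  have hCpos : 0 < C := by linarith
  have hCS : C ^ 2 = 1 - S ^ 2 := by rw [hCdef, hSdef, Real.cos_sq']
  set T := y * S / (x * C) with hT
  have hTx : y * S = T * (x * C) := by rw [hT]; field_simp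
  set u := |T| * x with hu
  have hu0 : 0 ≤ u := by positivity
  have huθ : u ≤ 101 / 100 * θ := by
    have h1 : |y| * S = u * C := by
      rw [← abs_of_nonneg hS0, ← abs_mul, hTx, abs_mul, abs_of_pos (mul_pos hx hCpos), hu]
      ring
    nlinarith [abs_nonneg y]
  have hT18 : |T| ≤ 18 / 100 := by
    have h1 : u ^ 2 ≤ (101 / 100 * θ) ^ 2 := by gcongr
    have h2 : θ ^ 2 ≤ (ε / 4) ^ 2 := by gcongr
    have h3 : |T| ^ 2 * ε ≤ u ^ 2 := by
      rw [hu, mul_pow]; gcongr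
    have h4 : |T| ^ 2 * ε ≤ (18 / 100) ^ 2 * ε := by nlinarith
    exact le_of_sq_le_sq (le_of_mul_le_mul_right h4 hε) (by norm_num)
  have hT1 : T ≤ 18 / 100 := (le_abs_self T).trans hT18
  have hlog : |Real.log (1 - T) + T + T ^ 2 / 2| ≤ |T| ^ 3 / (82 / 100) := by
    have h1 := Real.abs_log_sub_add_sum_range_le (x := T) (by linarith) 2
    norm_num [Finset.sum_range_succ] at h1
    rw [show Real.log (1 - T) + T + T ^ 2 / 2 = T + T ^ 2 / 2 + Real.log (1 - T) by ring]
    refine h1.trans ?_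
    gcongr
    linarith
  have hquot : Real.log (x ^ 2 / (x * C - y * S) ^ 2)
      = -Real.log (C ^ 2) - 2 * Real.log (1 - T) := by
    have h1 : 0 < 1 - T := by linarith
    have h2 : x ^ 2 / (x * C - y * S) ^ 2 = (C ^ 2 * (1 - T) ^ 2)⁻¹ := by
      rw [hTx]
      have : x * C - T * (x * C) = x * (C * (1 - T)) := by ring
      rw [this]
      field_simp
    rw [h2, Real.log_inv, Real.log_mul (by positivity) (by positivity), Real.log_pow (1 - T)]
    push_cast
    ring
  have hratio : (x * C + y * S) ^ 2 / x ^ 2 = C ^ 2 * (1 + T) ^ 2 := by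
    rw [hTx]
    field_simp
  have hres : Real.log (x ^ 2 / (x * C - y * S) ^ 2) + 1 + (Real.log (C ^ 2) + C ^ 2 - 1)
        - (x * C + y * S) ^ 2 / x ^ 2
      = -2 * (Real.log (1 - T) + T + T ^ 2 / 2) + S ^ 2 * (T * (2 + T)) := by
    rw [hquot, hratio, hCS]
    ring
  rw [hres]
  have hbound : |-2 * (Real.log (1 - T) + T + T ^ 2 / 2) + S ^ 2 * (T * (2 + T))|
      ≤ 2 * (|T| ^ 3 / (82 / 100)) + θ ^ 2 * (|T| * (218 / 100)) := by
    refine (abs_add_le _ _).trans (add_le_add ?_ ?_)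
    · rw [abs_mul, abs_neg, abs_two]
      gcongr
    · rw [abs_mul, abs_mul, abs_of_nonneg (sq_nonneg S)]
      have : |2 + T| ≤ 218 / 100 := (abs_add_le _ _).trans (by rw [abs_two]; linarith)
      gcongr
  have hxε' : ε ≤ x := by nlinarith
  refine (mul_le_mul_of_nonneg_right hbound (sq_nonneg x)).trans ?_
  rw [le_div_iff₀ hε]
  have h1 : |T| ^ 3 * x ^ 2 * ε ≤ u ^ 3 := by
    calc |T| ^ 3 * x ^ 2 * ε ≤ |T| ^ 3 * x ^ 2 * x := by gcongr
      _ = u ^ 3 := by rw [hu]; ring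
  have h2 : u ^ 3 ≤ (101 / 100 * θ) ^ 3 := by gcongr
  have h3 : θ ^ 2 * (|T| * x ^ 2 * ε) ≤ θ ^ 2 * (101 / 100 * θ * (1 * (1 / 2))) := by
    rw [show |T| * x ^ 2 * ε = u * (x * ε) by rw [hu]; ring]
    gcongr
  have h4 : 0 < θ ^ 3 := by positivity
  nlinarith

open Finset in
/-- The great circle through orthonormal `a`, `u` stays on the unit sphere. -/
lemma sum_sq_cos_add_sin {ι : Type*} [Fintype ι] {a u : ι → ℝ} (ha : ∑ i, a i ^ 2 = 1)
    (hu : ∑ i, u i ^ 2 = 1) (hau : ∑ i, a i * u i = 0) {C S : ℝ} (hCS : S ^ 2 + C ^ 2 = 1) :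
    ∑ i, (C * a i + S * u i) ^ 2 = 1 := by
  have : ∀ i, (C * a i + S * u i) ^ 2 = C ^ 2 * a i ^ 2 + S ^ 2 * u i ^ 2
      + 2 * C * S * (a i * u i) := fun i => by ring
  simp only [this, sum_add_distrib, ← mul_sum, ha, hu, hau]
  linarith


open Finset in
/-- Stationarity residual at angle `φ` of the great circle through orthonormal `a`, `u`. -/
lemma great_circle_residual_bound {ι : Type*} [Fintype ι] {a u : ι → ℝ} (ha : ∑ i, a i ^ 2 = 1)
    (hu : ∑ i, u i ^ 2 = 1) (hau : ∑ i, a i * u i = 0) {ε θ φ : ℝ} (hε : 0 < ε)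
    (hε1 : ε ≤ 1 / 2) (hθ : 0 < θ) (hθε : θ ≤ ε / 4) (i : ι)
    (hx0 : 0 ≤ Real.cos φ * a i + Real.sin φ * u i)
    (hxε : ε ≤ (Real.cos φ * a i + Real.sin φ * u i) ^ 2) :
    |Real.log ((Real.cos φ * a i + Real.sin φ * u i) ^ 2
          / (Real.cos (φ - θ) * a i + Real.sin (φ - θ) * u i) ^ 2) + 1
        + (Real.log (Real.cos θ ^ 2) + Real.cos θ ^ 2 - 1)
        - (Real.cos (φ + θ) * a i + Real.sin (φ + θ) * u i) ^ 2
          / (Real.cos φ * a i + Real.sin φ * u i) ^ 2|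
      * (Real.cos φ * a i + Real.sin φ * u i) ^ 2 ≤ 5 * θ ^ 3 / ε := by
  have hprev : Real.cos (φ - θ) * a i + Real.sin (φ - θ) * u i
      = (Real.cos φ * a i + Real.sin φ * u i) * Real.cos θ
        - (-Real.sin φ * a i + Real.cos φ * u i) * Real.sin θ := by
    rw [Real.cos_sub, Real.sin_sub]; ring
  have hnext : Real.cos (φ + θ) * a i + Real.sin (φ + θ) * u i
      = (Real.cos φ * a i + Real.sin φ * u i) * Real.cos θ
        + (-Real.sin φ * a i + Real.cos φ * u i) * Real.sin θ := by
    rw [Real.cos_add, Real.sin_add]; ring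
  have hcoord : ∀ {C S : ℝ}, S ^ 2 + C ^ 2 = 1 → |C * a i + S * u i| ≤ 1 := fun {C S} hCS => by
    have h1 := single_le_sum (f := fun j => (C * a j + S * u j) ^ 2)
      (fun j _ => sq_nonneg _) (mem_univ i)
    rw [sum_sq_cos_add_sin ha hu hau hCS] at h1
    exact (sq_le_one_iff_abs_le_one _).1 h1
  have hx : 0 < Real.cos φ * a i + Real.sin φ * u i := hx0.lt_of_ne fun h => by
    rw [← h] at hxε
    norm_num at hxε
    exact hxε.not_gt hε
  rw [hprev, hnext]
  exact slerp_residual_bound hε1 hx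
    ((le_abs_self _).trans (hcoord (Real.sin_sq_add_cos_sq φ))) hxε
    (hcoord (by rw [neg_sq]; exact Real.cos_sq_add_sin_sq φ)) hθ hθε

/-- Sub-optimality bound for SLERP on the exact KL cost. With weights bounded
below by `ε` at the endpoints and along the `f`-step SLERP path, and `f ≥ 4Ω/ε`, the total
exact KL cost of the SLERP path exceeds the infimum over all `f`-step paths of weight
vectors (with components `≥ ε`) by at most `(86·N/ε⁴)·Ω⁴/f³`. -/
theorem slerp_suboptimality_bound (N : ℕ) (hN : 1 ≤ N) (ε : ℝ) (hε : 0 < ε)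
    (ws we : Fin N → ℝ)
    (hws : ∀ i, 0 < ws i) (hws1 : ∑ i, ws i = 1)
    (hwe : ∀ i, 0 < we i) (hwe1 : ∑ i, we i = 1)
    (hne : ws ≠ we)
    (hwsε : ∀ i, ε ≤ ws i) (hweε : ∀ i, ε ≤ we i)
    (Ω : ℝ) (hΩ : Ω = Real.arccos (∑ i, Real.sqrt (ws i * we i)))
    (w : ℝ → Fin N → ℝ)
    (hw : ∀ t i, w t i = ((Real.sin ((1 - t) * Ω) * Real.sqrt (ws i)
        + Real.sin (t * Ω) * Real.sqrt (we i)) / Real.sin Ω) ^ 2)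
    (f : ℕ) (hf : 4 * Ω / ε ≤ (f : ℝ))
    (hpath : ∀ k ≤ f, ∀ i, ε ≤ w ((k : ℝ) / f) i)
    (CSLERP : ℝ)
    (hCS : CSLERP = ∑ k ∈ Finset.range f, ∑ i,
        w (((k : ℝ) + 1) / f) i *
          Real.log (w (((k : ℝ) + 1) / f) i / w ((k : ℝ) / f) i))
    (Copt : ℝ)
    (hCopt : Copt = sInf {c : ℝ | ∃ v : ℕ → Fin N → ℝ,
        (∀ k ≤ f, (∀ i, 0 < v k i) ∧ (∑ i, v k i = 1) ∧ (∀ i, ε ≤ v k i)) ∧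
        v 0 = ws ∧ v f = we ∧
        c = ∑ k ∈ Finset.range f, ∑ i,
          v (k + 1) i * Real.log (v (k + 1) i / v k i)}) :
    0 ≤ CSLERP - Copt ∧ CSLERP - Copt ≤ 86 * N / ε ^ 4 * Ω ^ 4 / f ^ 3 := by
  have hsa : ∀ i, 0 ≤ √(ws i) := fun i => Real.sqrt_nonneg _
  have hsb : ∀ i, 0 ≤ √(we i) := fun i => Real.sqrt_nonneg _
  obtain ⟨a, ha⟩ : ∃ a : Fin N → ℝ, ∀ i, a i = √(ws i) := ⟨_, fun _ => rfl⟩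
  obtain ⟨b, hb⟩ : ∃ b : Fin N → ℝ, ∀ i, b i = √(we i) := ⟨_, fun _ => rfl⟩
  have ha2 : ∀ i, a i ^ 2 = ws i := fun i => by rw [ha, Real.sq_sqrt (hws i).le]
  have hb2 : ∀ i, b i ^ 2 = we i := fun i => by rw [hb, Real.sq_sqrt (hwe i).le]
  have hsuma : ∑ i, a i ^ 2 = 1 := by simp only [ha2, hws1]
  have hsumb : ∑ i, b i ^ 2 = 1 := by simp only [hb2, hwe1]
  have hin : ∑ i, √(ws i * we i) = ∑ i, a i * b i := by
    simp only [ha, hb, Real.sqrt_mul (hws _).le]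
  rw [hin] at hΩ
  have hdist : ∑ i, (a i - b i) ^ 2 = 2 - 2 * ∑ i, a i * b i := by
    have : ∀ i, (a i - b i) ^ 2 = a i ^ 2 + b i ^ 2 - 2 * (a i * b i) := fun i => by ring
    simp only [this, Finset.sum_sub_distrib, Finset.sum_add_distrib, ← Finset.mul_sum, hsuma, hsumb]
    ring
  have hin0 : 0 ≤ ∑ i, a i * b i :=
    Finset.sum_nonneg fun i _ => mul_nonneg (ha i ▸ hsa i) (hb i ▸ hsb i)
  have hin1 : ∑ i, a i * b i < 1 := by
    obtain ⟨j, hj⟩ := Function.ne_iff.1 hne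
    have hab : a j - b j ≠ 0 := fun h => hj (by rw [← ha2, ← hb2, sub_eq_zero.1 h])
    have : 0 < ∑ i, (a i - b i) ^ 2 :=
      Finset.sum_pos' (fun i _ => sq_nonneg _) ⟨j, Finset.mem_univ j, by positivity⟩
    linarith
  have hΩ0 : 0 < Ω := by rw [hΩ]; exact Real.arccos_pos.2 hin1
  have hΩ1 : Ω ≤ Real.pi / 2 := by rw [hΩ]; exact Real.arccos_le_pi_div_two.2 hin0
  have hcos : Real.cos Ω = ∑ i, a i * b i := by
    rw [hΩ, Real.cos_arccos (by linarith) hin1.le]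
  have hpi := Real.pi_pos
  have hsin : 0 < Real.sin Ω := Real.sin_pos_of_pos_of_lt_pi hΩ0 (by linarith)
  have hfR : (0 : ℝ) < f := lt_of_lt_of_le (by positivity) hf
  have hf0 : 0 < f := by exact_mod_cast hfR
  have hε1 : ε ≤ 1 / 2 := by
    have hN2 : 2 ≤ N := by
      by_contra h
      obtain rfl : N = 1 := by omega
      apply hne
      ext i
      rw [Subsingleton.elim i 0]
      simp only [Fin.sum_univ_one] at hws1 hwe1
      rw [hws1, hwe1]
    have h1 := Finset.sum_le_sum fun i (_ : i ∈ Finset.univ) => hwsε i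
    rw [hws1, Finset.sum_const, Finset.card_univ, Fintype.card_fin, nsmul_eq_mul] at h1
    have h2 : (2 : ℝ) ≤ N := by exact_mod_cast hN2
    nlinarith
  obtain ⟨u, hu⟩ : ∃ u : Fin N → ℝ, ∀ i, u i = (b i - Real.cos Ω * a i) / Real.sin Ω :=
    ⟨_, fun _ => rfl⟩
  have hau : ∑ i, a i * u i = 0 := by
    have : ∀ i, a i * u i = (a i * b i - Real.cos Ω * a i ^ 2) / Real.sin Ω := fun i => by
      rw [hu]; ring
    simp only [this, ← Finset.sum_div, Finset.sum_sub_distrib, ← Finset.mul_sum, hsuma, ← hcos]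
    simp
  have hsumu : ∑ i, u i ^ 2 = 1 := by
    have : ∀ i, u i ^ 2 = (b i ^ 2 - 2 * Real.cos Ω * (a i * b i) + Real.cos Ω ^ 2 * a i ^ 2)
        / Real.sin Ω ^ 2 := fun i => by rw [hu]; ring
    simp only [this, ← Finset.sum_div, Finset.sum_sub_distrib, Finset.sum_add_distrib,
      ← Finset.mul_sum, hsuma, hsumb, ← hcos]
    rw [div_eq_one_iff_eq (by positivity), Real.sin_sq]
    ring
  have hη : ∀ t i, (Real.sin ((1 - t) * Ω) * √(ws i) + Real.sin (t * Ω) * √(we i)) / Real.sin Ω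
      = Real.cos (t * Ω) * a i + Real.sin (t * Ω) * u i := fun t i => by
    rw [← ha, ← hb, hu, show (1 - t) * Ω = Ω - t * Ω by ring, Real.sin_sub]
    field_simp
    ring
  have hw' : ∀ t i, w t i = (Real.cos (t * Ω) * a i + Real.sin (t * Ω) * u i) ^ 2 :=
    fun t i => by rw [hw, hη]
  have hw1 : ∀ t, ∑ i, w t i = 1 := fun t => by
    simp only [hw']
    exact sum_sq_cos_add_sin hsuma hsumu hau (Real.sin_sq_add_cos_sq _)
  have hw_zero : w 0 = ws := by
    ext i; simp [hw', ha2]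
  have hw_one : w 1 = we := by
    ext i
    rw [hw', hu, ← hb2]
    congr 1
    rw [one_mul]
    field_simp
    ring
  have hW0 : w (((0 : ℕ) : ℝ) / f) = ws := by simpa using hw_zero
  have hWf : w ((f : ℝ) / f) = we := by rw [div_self hfR.ne', hw_one]
  have hCS' : CSLERP = ∑ k ∈ Finset.range f, ∑ i,
      w (((k + 1 : ℕ) : ℝ) / f) i *
        Real.log (w (((k + 1 : ℕ) : ℝ) / f) i / w ((k : ℝ) / f) i) := by
    rw [hCS]; push_cast; rfl
  have hmem : CSLERP ∈ {c : ℝ | ∃ v : ℕ → Fin N → ℝ,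
        (∀ k ≤ f, (∀ i, 0 < v k i) ∧ (∑ i, v k i = 1) ∧ (∀ i, ε ≤ v k i)) ∧
        v 0 = ws ∧ v f = we ∧
        c = ∑ k ∈ Finset.range f, ∑ i,
          v (k + 1) i * Real.log (v (k + 1) i / v k i)} :=
    ⟨fun k => w ((k : ℝ) / f), fun k hk =>
      ⟨fun i => hε.trans_le (hpath k hk i), hw1 _, hpath k hk⟩, hW0, hWf, hCS'⟩
  constructor
  · rw [sub_nonneg, hCopt]
    refine csInf_le ⟨0, ?_⟩ hmem
    rintro c ⟨v, hv, -, -, rfl⟩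
    refine Finset.sum_nonneg fun k hk => ?_
    have hk' : k < f := Finset.mem_range.1 hk
    exact sum_mul_log_div_nonneg (hv (k + 1) hk').1 (hv k hk'.le).1
      (by rw [(hv (k + 1) hk').2.1, (hv k hk'.le).2.1])
  · rw [sub_le_comm, hCopt]
    refine le_csInf ⟨_, hmem⟩ ?_
    rintro c ⟨v, hv, hv0, hvf, rfl⟩
    rw [sub_le_comm]
    set θ := Ω / f with hθ
    have hθ0 : 0 < θ := by positivity
    have hθε : θ ≤ ε / 4 := by
      rw [hθ, div_le_iff₀ hfR]
      rw [div_le_iff₀ hε] at hf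
      linarith
    have hres : ∀ k, 0 < k → k < f → ∀ i,
        |Real.log (w ((k : ℝ) / f) i / w (((k - 1 : ℕ) : ℝ) / f) i) + 1
          + (Real.log (Real.cos θ ^ 2) + Real.cos θ ^ 2 - 1)
          - w (((k + 1 : ℕ) : ℝ) / f) i / w ((k : ℝ) / f) i| * w ((k : ℝ) / f) i
          ≤ 5 * θ ^ 3 / ε := by
      intro k hk0 hkf i
      obtain ⟨φ, hφ⟩ : ∃ φ, φ = (k : ℝ) / f * Ω := ⟨_, rfl⟩
      have hprev : ((k - 1 : ℕ) : ℝ) / f * Ω = φ - θ := by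
        rw [Nat.cast_sub hk0, hφ, hθ]; push_cast; ring
      have hnext : ((k + 1 : ℕ) : ℝ) / f * Ω = φ + θ := by
        rw [hφ, hθ]; push_cast; ring
      have hkR : (k : ℝ) / f ≤ 1 := (div_le_one hfR).2 (by exact_mod_cast hkf.le)
      have hk0R : 0 ≤ (k : ℝ) / f := by positivity
      have hx0 : 0 ≤ Real.cos φ * a i + Real.sin φ * u i := by
        rw [hφ, ← hη]
        have h1 : 0 ≤ Real.sin ((1 - (k : ℝ) / f) * Ω) :=
          Real.sin_nonneg_of_nonneg_of_le_pi (mul_nonneg (by linarith) hΩ0.le) (by nlinarith)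
        have h2 : 0 ≤ Real.sin ((k : ℝ) / f * Ω) :=
          Real.sin_nonneg_of_nonneg_of_le_pi (by positivity) (by nlinarith)
        positivity
      have hxε := hpath k hkf.le i
      rw [hw', ← hφ] at hxε
      simp only [hw', hprev, hnext]
      rw [← hφ]
      exact great_circle_residual_bound hsuma hsumu hau hε hε1 hθ0 hθε i hx0 hxε
    have hmain := cost_sub_le_of_residual hf0 hε (fun k => w ((k : ℝ) / f)) v hpath
      (fun k _ => hw1 _) (fun k hk => (hv k hk).2.2) (fun k hk => (hv k hk).2.1)
      (hv0.trans hW0.symm) (hvf.trans hWf.symm) hres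
    rw [← hCS'] at hmain
    refine hmain.trans ?_
    have hΩ2 : 25 * Ω ^ 2 ≤ 86 := by nlinarith [Real.pi_lt_d2]
    have h1 : (N : ℝ) * ((5 * θ ^ 3 / ε) ^ 2 * f ^ 3 / ε ^ 2)
        = (25 * Ω ^ 2) * (N / ε ^ 4 * Ω ^ 4 / f ^ 3) := by
      rw [hθ]
      field_simp
      norm_num
    have h2 : 86 * N / ε ^ 4 * Ω ^ 4 / f ^ 3 = 86 * (N / ε ^ 4 * Ω ^ 4 / (f : ℝ) ^ 3) := by ring
    rw [h1, h2]
    gcongr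
end

section
/- Let N ≥ 1, let w and w′ be weight vectors on the simplex, let P, P′ : Fin N → ℝ be strictly positive price vectors, and let R : Fin N → ℝ be strictly positive reserves in equilibrium at prices P with weights w, i.e. P_i R_i = w_i V for all i where V = ∑_j P_j R_j. Define the post-arbitrage equilibrium value at the new weights and new prices by V′ = (∏_i R_i^{w′_i}) · ∏_i (P′_i / w′_i)^{w′_i}. Then the value change factorises as V′/V = r · ∏_i (P′_i / P_i)^{w′_i}, where r = ∏_i (w_i / w′_i)^{w′_i} is the retention ratio. In particular, the retention ratio factor depends only on the weight change and not on the prices. -/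
/-- Price-independence of the retention ratio. If `R` is an equilibrium at
prices `P` with weights `w`, and the post-arbitrage equilibrium value at the new weights
`w'` and new prices `P'` is `V' = (∏ i, R i ^ w' i) · ∏ i, (P' i / w' i) ^ w' i`, then
`V'/V = r · ∏ i, (P' i / P i) ^ w' i` with `r = ∏ i, (w i / w' i) ^ w' i`, so the
retention factor depends only on the weight change. -/
theorem value_change_factorisation (N : ℕ) (hN : 1 ≤ N)
    (w w' P P' R : Fin N → ℝ)
    (hw : ∀ i, 0 < w i) (hw1 : ∑ i, w i = 1)
    (hw' : ∀ i, 0 < w' i) (hw'1 : ∑ i, w' i = 1)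
    (hP : ∀ i, 0 < P i) (hP' : ∀ i, 0 < P' i)
    (hR : ∀ i, 0 < R i)
    (heq : ∀ i, P i * R i = w i * ∑ j, P j * R j) :
    ((∏ i, R i ^ w' i) * ∏ i, (P' i / w' i) ^ w' i) / (∑ j, P j * R j)
      = (∏ i, (w i / w' i) ^ w' i) * ∏ i, (P' i / P i) ^ w' i := by
  have hV : 0 < ∑ j, P j * R j :=
    Finset.sum_pos (fun i _ => mul_pos (hP i) (hR i)) ⟨⟨0, hN⟩, Finset.mem_univ _⟩
  generalize ∑ j, P j * R j = V at heq hV ⊢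
  have hVprod : ∏ i, V ^ w' i = V := by
    rw [← Real.rpow_sum_of_pos hV, hw'1, Real.rpow_one]
  rw [div_eq_iff hV.ne', ← hVprod]
  simp only [← Finset.prod_mul_distrib]
  refine Finset.prod_congr rfl fun i _ => ?_
  have hwi := hw i
  have hwi' := hw' i
  have hPi := hP i
  have hPi' := hP' i
  have hRi := hR i
  rw [← Real.mul_rpow (by positivity) (by positivity),
    ← Real.mul_rpow (by positivity) (by positivity),
    ← Real.mul_rpow (by positivity) (by positivity)]
  congr 1
  field_simp
  linear_combination heq i
end

section
/- Let Ω > 0, let F > 0 (the fee-band threshold step count), and let c > 0 (the fee-adjusted per-step LVR cost, c = Δt·ℓ̄·φ with φ > 0). Define C_φ : (0, ∞) → ℝ by C_φ(f) = 2Ω²/min(f, F) + f·c. Then C_φ attains its global minimum on (0, ∞) at f*_φ = min(Ω·√(2/c), F). Moreover, if instead c ≤ 0, then C_φ is non-increasing on (0, ∞), so no finite minimiser exists. -/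
/-- On `(0, F]`, the function `g ↦ c t² / g + g c` is minimised at `min t F`. -/
theorem mul_div_add_mul_le_of_le {c t F g : ℝ} (hc : 0 < c) (ht : 0 < t) (hF : 0 < F)
    (hg : 0 < g) (hgF : g ≤ F) :
    c * t ^ 2 / min t F + min t F * c ≤ c * t ^ 2 / g + g * c := by
  have hm : 0 < min t F := lt_min ht hF
  have hprod : 0 ≤ (g - min t F) * (g * min t F - t ^ 2) := by
    rcases le_total t F with h | h
    · rw [min_eq_left h]
      nlinarith [mul_nonneg ht.le (sq_nonneg (g - t))]
    · rw [min_eq_right h]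
      exact mul_nonneg_of_nonpos_of_nonpos (by linarith) (by nlinarith)
  have hdiff : c * t ^ 2 / g + g * c - (c * t ^ 2 / min t F + min t F * c) =
      c * ((g - min t F) * (g * min t F - t ^ 2)) / (g * min t F) := by
    field_simp
    ring
  rw [← sub_nonneg, hdiff]
  positivity

/-- Fee-adjusted optimal step count. With the plateaued cost
`C_φ(f) = 2Ω²/min(f,F) + f·c` on `(0,∞)`: if `c > 0` then `C_φ` attains its global
minimum at `f*_φ = min (Ω·√(2/c)) F`; if instead `c ≤ 0` then `C_φ` is non-increasing
on `(0,∞)`, so no finite minimiser exists. -/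
theorem fee_adjusted_optimal_step_count (Ω F c : ℝ) (hΩ : 0 < Ω) (hF : 0 < F)
    (Cφ : ℝ → ℝ) (hCφ : ∀ f, Cφ f = 2 * Ω ^ 2 / min f F + f * c) :
    (0 < c → ∀ f : ℝ, 0 < f → Cφ (min (Ω * Real.sqrt (2 / c)) F) ≤ Cφ f) ∧
    (c ≤ 0 → AntitoneOn Cφ (Set.Ioi (0 : ℝ))) := by
  refine ⟨fun hc f hf => ?_, fun hc x hx y _ hxy => ?_⟩
  · have hsqrt : 0 < Real.sqrt (2 / c) := Real.sqrt_pos.2 (by positivity)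
    have hsq : 2 * Ω ^ 2 = c * (Ω * Real.sqrt (2 / c)) ^ 2 := by
      rw [mul_pow, Real.sq_sqrt (by positivity)]
      field_simp
    rw [hCφ, hCφ, min_assoc, min_self, hsq]
    have ht : 0 < Ω * Real.sqrt (2 / c) := mul_pos hΩ hsqrt
    have hmin := mul_div_add_mul_le_of_le hc ht hF (lt_min hf hF) (min_le_right f F)
    have hle : min f F * c ≤ f * c := mul_le_mul_of_nonneg_right (min_le_left f F) hc.le
    linarith
  · rw [hCφ, hCφ]
    have hx' : 0 < min x F := lt_min hx hF
    have hdiv : 2 * Ω ^ 2 / min y F ≤ 2 * Ω ^ 2 / min x F :=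
      div_le_div_of_nonneg_left (by positivity) hx' (min_le_min_right F hxy)
    have hmul : y * c ≤ x * c := mul_le_mul_of_nonpos_right hxy hc
    exact add_le_add hdiv hmul
end

section
/- Let N ≥ 1, let w and w′ be weight vectors on the simplex, let P : Fin N → ℝ be strictly positive prices, and let R, R′ : Fin N → ℝ be strictly positive reserve vectors such that: (i) R is in equilibrium at prices P with weights w (P_i R_i = w_i V with V = ∑_j P_j R_j); (ii) R′ is in equilibrium at prices P with weights w′ (P_i R′_i = w′_i V′ with V′ = ∑_j P_j R′_j); and (iii) the invariant with the new weights is preserved, ∏_i (R′_i)^{w′_i} = ∏_i R_i^{w′_i}. Then for every i, R′_i = R_i · (w′_i / w_i) · ∏_j (w_j / w′_j)^{w′_j}. -/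
/-- Post-arbitrage reserves after a weight change at constant prices. If `R`
is an equilibrium at prices `P` with weights `w`, `R'` is an equilibrium at prices `P`
with weights `w'`, and the invariant with the new weight exponents is preserved
(`∏ i, R' i ^ w' i = ∏ i, R i ^ w' i`), then
`R' i = R i · (w' i / w i) · ∏ j, (w j / w' j) ^ w' j` for every `i`. -/
theorem reserve_change_formula (N : ℕ) (hN : 1 ≤ N)
    (w w' P R R' : Fin N → ℝ)
    (hw : ∀ i, 0 < w i) (hw1 : ∑ i, w i = 1)
    (hw' : ∀ i, 0 < w' i) (hw'1 : ∑ i, w' i = 1)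
    (hP : ∀ i, 0 < P i) (hR : ∀ i, 0 < R i) (hR' : ∀ i, 0 < R' i)
    (heq : ∀ i, P i * R i = w i * ∑ j, P j * R j)
    (heq' : ∀ i, P i * R' i = w' i * ∑ j, P j * R' j)
    (hinv : ∏ i, R' i ^ w' i = ∏ i, R i ^ w' i) :
    ∀ i, R' i = R i * (w' i / w i) * ∏ j, (w j / w' j) ^ w' j := by
  have hne : (Finset.univ : Finset (Fin N)).Nonempty := ⟨⟨0, hN⟩, Finset.mem_univ _⟩
  have hV : 0 < ∑ j, P j * R j := Finset.sum_pos (fun j _ => mul_pos (hP j) (hR j)) hne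
  have hV' : 0 < ∑ j, P j * R' j := Finset.sum_pos (fun j _ => mul_pos (hP j) (hR' j)) hne
  generalize ∑ j, P j * R j = V at heq hV
  generalize ∑ j, P j * R' j = V' at heq' hV'
  have ratio : ∀ j, w j / w' j = R j / R' j * (V' / V) := by
    intro j
    have hwj : w j = P j * R j / V := by rw [heq j, mul_div_cancel_right₀ _ hV.ne']
    have hwj' : w' j = P j * R' j / V' := by rw [heq' j, mul_div_cancel_right₀ _ hV'.ne']
    have := (hP j).ne'
    have := (hR' j).ne'
    rw [hwj, hwj']
    field_simp
  have hprod : ∏ j, (w j / w' j) ^ w' j = V' / V := by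
    have hterm : ∀ j, (w j / w' j) ^ w' j
        = R j ^ w' j / R' j ^ w' j * (V' / V) ^ w' j := by
      intro j
      rw [ratio j, Real.mul_rpow (div_pos (hR j) (hR' j)).le (div_pos hV' hV).le,
        Real.div_rpow (hR j).le (hR' j).le]
    have hpos : 0 < ∏ j, R j ^ w' j :=
      Finset.prod_pos fun j _ => Real.rpow_pos_of_pos (hR j) _
    simp_rw [hterm]
    rw [Finset.prod_mul_distrib, Finset.prod_div_distrib, hinv, div_self hpos.ne', one_mul,
      ← Real.rpow_sum_of_pos (div_pos hV' hV), hw'1, Real.rpow_one]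
  intro i
  have hi : w' i / w i = R' i / R i * (V / V') := by
    rw [← inv_div, ratio i, mul_inv, inv_div, inv_div]
  have := (hR i).ne'
  rw [hprod, hi]
  field_simp
end
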